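/- arXiv:1412.5641 — 2 statements merged into one kernel-verified Lean document; each statement's English description precedes it below -/
import Mathlib

section
/- Let 0 < ε ≤ ε₀ and let h ∈ W^{1,p}(D_ε; ω^ε) for some 1 ≤ p ≤ ∞. Then there exists a constant C > 0 independent of ε such that the diffuse volume error satisfies |E_V(h)| = |∫_Ω h ω^ε dx − ∫_D h dx| ≤ C ε^{2−1/p} ‖h‖_{W^{1,p}(Γ_ε;ω^ε)} (with 1/p = 0 when p = ∞). -/
open MeasureTheory ENNReal Set Filter Topology
open scoped RealInnerProductSpace

noncomputable section

/-- The weighted measure `w dx` restricted to the set `U`. -/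
def wMeas {n : ℕ} (U : Set (EuclideanSpace ℝ (Fin n)))
    (w : EuclideanSpace ℝ (Fin n) → ℝ) : Measure (EuclideanSpace ℝ (Fin n)) :=
  (volume.restrict U).withDensity fun x => ENNReal.ofReal (w x)

section Steklov

variable {E : Type*} [NormedAddCommGroup E] [NormedSpace ℝ E]

/-- The Steklov average of `f` over the segment `[x, x + t v]`. -/
def steklov (f : E → ℝ) (v : E) (t : ℝ) (x : E) : ℝ :=
  t⁻¹ * ∫ s in (0 : ℝ)..t, f (x + s • v)

lemma continuous_steklov {f : E → ℝ} (hf : Continuous f) (v : E) (t : ℝ) :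
    Continuous (steklov f v t) := by
  unfold steklov
  refine continuous_const.mul ?_
  exact intervalIntegral.continuous_parametric_intervalIntegral_of_continuous' (by fun_prop) _ _

lemma hasLineDerivAt_steklov {f : E → ℝ} (hf : Continuous f) (v : E) (t : ℝ) (x : E) :
    HasLineDerivAt ℝ (steklov f v t) (t⁻¹ * (f (x + t • v) - f x)) x v := by
  have hc : Continuous fun s : ℝ => f (x + s • v) := by fun_prop
  have hF (r : ℝ) : HasDerivAt (fun r => ∫ s in (0 : ℝ)..r, f (x + s • v)) (f (x + r • v)) r :=
    intervalIntegral.integral_hasDerivAt_right (hc.intervalIntegrable _ _)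
      (hc.stronglyMeasurableAtFilter _ _) hc.continuousAt
  have key : (fun r : ℝ => steklov f v t (x + r • v)) =
      fun r => t⁻¹ * ((∫ s in (0 : ℝ)..(r + t), f (x + s • v)) -
        ∫ s in (0 : ℝ)..r, f (x + s • v)) := by
    funext r
    rw [intervalIntegral.integral_interval_sub_left (hc.intervalIntegrable _ _)
      (hc.intervalIntegrable _ _)]
    have := intervalIntegral.integral_comp_add_left (a := 0) (b := t)
      (fun s => f (x + s • v)) r
    simp only [add_zero] at this
    rw [← this]
    simp only [steklov, add_smul, add_assoc]
  unfold HasLineDerivAt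
  rw [key]
  have h1 : HasDerivAt (fun r => ∫ s in (0 : ℝ)..(r + t), f (x + s • v)) (f (x + t • v)) 0 := by
    have := (hF (0 + t)).comp_add_const 0 t
    simpa using this
  have h2 := hF 0
  simp only [zero_smul, add_zero] at h2
  exact (h1.sub h2).const_mul _

lemma abs_steklov_sub_le {f : E → ℝ} {C : NNReal} (hf : LipschitzWith C f) (v : E) {t : ℝ}
    (ht : 0 < t) (x : E) : |steklov f v t x - f x| ≤ C * ‖v‖ * t := by
  have hc : Continuous fun s : ℝ => f (x + s • v) := by
    have := hf.continuous
    fun_prop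
  have h1 : steklov f v t x - f x = t⁻¹ * ∫ s in (0 : ℝ)..t, (f (x + s • v) - f x) := by
    rw [intervalIntegral.integral_sub (hc.intervalIntegrable _ _) (by simp)]
    simp only [steklov, intervalIntegral.integral_const, sub_zero, smul_eq_mul]
    field_simp
  have h2 : ‖∫ s in (0 : ℝ)..t, (f (x + s • v) - f x)‖ ≤ (C * ‖v‖ * t) * |t - 0| := by
    refine intervalIntegral.norm_integral_le_of_norm_le_const fun s hs => ?_
    rw [uIoc_of_le ht.le] at hs
    have := hf.norm_sub_le (x + s • v) x
    rw [add_sub_cancel_left, norm_smul, Real.norm_eq_abs s, abs_of_pos hs.1] at this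
    calc _ ≤ C * (s * ‖v‖) := this
      _ ≤ C * (t * ‖v‖) := by gcongr; exact hs.2
      _ = _ := by ring
  rw [h1, abs_mul, abs_inv, abs_of_pos ht, inv_mul_le_iff₀ ht]
  rw [sub_zero, abs_of_pos ht, Real.norm_eq_abs] at h2
  linarith

lemma steklov_eq_zero_of_notMem_cthickening {f : E → ℝ} {v : E} {t δ : ℝ} (ht : 0 < t)
    (htδ : t * ‖v‖ ≤ δ) {x : E} (hx : x ∉ Metric.cthickening δ (tsupport f)) :
    steklov f v t x = 0 := by
  have : ∫ s in (0 : ℝ)..t, f (x + s • v) = ∫ s in (0 : ℝ)..t, (0 : ℝ) := by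
    refine intervalIntegral.integral_congr fun s hs => ?_
    rw [uIcc_of_le ht.le] at hs
    refine image_eq_zero_of_notMem_tsupport fun hmem => hx ?_
    refine Metric.mem_cthickening_of_dist_le _ _ _ _ hmem ?_
    rw [dist_self_add_right, norm_smul, Real.norm_eq_abs, abs_of_nonneg hs.1]
    exact (mul_le_mul_of_nonneg_right hs.2 (norm_nonneg v)).trans htδ
  simp [steklov, this]

end Steklov

section IntegrationByParts

variable {E : Type*} [NormedAddCommGroup E] [NormedSpace ℝ E] [FiniteDimensional ℝ E]
  [MeasurableSpace E] [BorelSpace E] {μ : Measure E} [μ.IsAddHaarMeasure]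

/-- Integration by parts against a compactly supported Lipschitz function. -/
lemma integral_mul_lineDeriv_eq_neg_of_lipschitzWith {V : Set E} (hV : IsOpen V) {u Y : E → ℝ}
    (hu : ∀ x ∈ V, DifferentiableAt ℝ u x) (hui : LocallyIntegrableOn u V μ)
    (hdui : LocallyIntegrableOn (fderiv ℝ u) V μ) {C : NNReal} (hY : LipschitzWith C Y)
    (hYc : HasCompactSupport Y) (hYV : tsupport Y ⊆ V) (v : E) :
    ∫ x, u x * lineDeriv ℝ Y x v ∂μ = -∫ x, fderiv ℝ u x v * Y x ∂μ := by
  obtain ⟨δ, hδ, hKV⟩ := IsCompact.exists_cthickening_subset_open hYc hV hYV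
  set K := Metric.cthickening δ (tsupport Y) with hK
  have hKc : IsCompact K := IsCompact.cthickening hYc
  have hYK : tsupport Y ⊆ K := Metric.self_subset_cthickening _
  have huK : IntegrableOn u K μ := hui.integrableOn_compact_subset hKV hKc
  have hdK : IntegrableOn (fun x => fderiv ℝ u x v) K μ :=
    (hdui.integrableOn_compact_subset hKV hKc).apply_continuousLinearMap v
  obtain ⟨B, hB⟩ : ∃ B, ∀ x, ‖Y x‖ ≤ B := hY.continuous.bounded_above_of_compact_support hYc
  have hsmall : ∀ᶠ t in 𝓝[>] (0 : ℝ), 0 < t ∧ t < 1 ∧ t * ‖v‖ ≤ δ := by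
    have h1 : ∀ᶠ t in 𝓝[>] (0 : ℝ), 0 < t := eventually_mem_nhdsWithin
    have h2 : ∀ᶠ t in 𝓝[>] (0 : ℝ), t < 1 :=
      mem_nhdsWithin_of_mem_nhds (Iio_mem_nhds one_pos)
    have h3 : ∀ᶠ t in 𝓝[>] (0 : ℝ), t * ‖v‖ < δ := by
      refine mem_nhdsWithin_of_mem_nhds ?_
      have : ContinuousAt (fun t : ℝ => t * ‖v‖) 0 := by fun_prop
      exact this.preimage_mem_nhds (Iio_mem_nhds (by simpa using hδ))
    filter_upwards [h1, h2, h3] with t a b c using ⟨a, b, c.le⟩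
  have hquot : ∀ t : ℝ, 0 < t → t * ‖v‖ ≤ δ → ∀ x ∉ K, Y (x + t • v) - Y x = 0 := by
    intro t ht htδ x hx
    rw [image_eq_zero_of_notMem_tsupport fun h => hx (hYK h), sub_zero]
    refine image_eq_zero_of_notMem_tsupport fun hmem => hx ?_
    refine Metric.mem_cthickening_of_dist_le _ _ _ _ hmem ?_
    rwa [dist_self_add_right, norm_smul, Real.norm_eq_abs, abs_of_pos ht]
  have hlim1 := hY.integral_inv_smul_sub_mul_tendsto_integral_lineDeriv_mul
    (μ := μ) (huK.integrable_indicator hKc.measurableSet) v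
  have hlim2 : Tendsto (fun t => -∫ x, fderiv ℝ u x v * steklov Y v t x ∂μ) (𝓝[>] (0 : ℝ))
      (𝓝 (-∫ x, fderiv ℝ u x v * Y x ∂μ)) := by
    refine Tendsto.neg (tendsto_integral_filter_of_dominated_convergence
      (K.indicator fun x => ‖fderiv ℝ u x v‖ * (C * ‖v‖ * 1 + B)) ?_ ?_ ?_ ?_)
    · filter_upwards with t
      exact (measurable_fderiv_apply_const ℝ u v).aestronglyMeasurable.mul
        (continuous_steklov hY.continuous v t).aestronglyMeasurable
    · filter_upwards [hsmall] with t ⟨ht, ht1, htδ⟩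
      filter_upwards with x
      by_cases hx : x ∈ K
      · rw [indicator_of_mem hx, norm_mul]
        gcongr
        have h1 := abs_steklov_sub_le hY v ht x
        have h2 : C * ‖v‖ * t ≤ C * ‖v‖ * 1 := by gcongr
        have h3 := hB x
        rw [Real.norm_eq_abs] at *
        have h4 := abs_sub_abs_le_abs_sub (steklov Y v t x) (Y x)
        linarith
      · rw [indicator_of_notMem hx, steklov_eq_zero_of_notMem_cthickening ht htδ hx]
        simp
    · exact (integrable_indicator_iff hKc.measurableSet).2 (hdK.norm.mul_const _)
    · filter_upwards with x
      refine Tendsto.const_mul _ ?_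
      rw [tendsto_iff_norm_sub_tendsto_zero]
      refine squeeze_zero' (g := fun t => C * ‖v‖ * t) (by simp) ?_ ?_
      · filter_upwards [hsmall] with t ht using abs_steklov_sub_le hY v ht.1 x
      · have : ContinuousAt (fun t : ℝ => C * ‖v‖ * t) 0 := by fun_prop
        have h := this.tendsto
        rw [mul_zero] at h
        exact h.mono_left nhdsWithin_le_nhds
  have heq : ∀ᶠ t in 𝓝[>] (0 : ℝ), ∫ x, (t⁻¹ • (Y (x + t • v) - Y x)) * K.indicator u x ∂μ =
      -∫ x, fderiv ℝ u x v * steklov Y v t x ∂μ := by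
    filter_upwards [hsmall] with t ⟨ht, ht1, htδ⟩
    have hsupp : tsupport (steklov Y v t) ⊆ K := by
      refine closure_minimal (fun x hx => ?_) hKc.isClosed
      by_contra h
      exact hx (steklov_eq_zero_of_notMem_cthickening ht htδ h)
    have hmul_int : ∀ {a b : E → ℝ}, IntegrableOn a K μ → Continuous b → (∀ x ∉ K, b x = 0) →
        Integrable (fun x => a x * b x) μ := by
      intro a b ha hb h0
      have h1 : IntegrableOn (fun x => a x * b x) K μ := ha.mul_continuousOn hb.continuousOn hKc
      refine (integrableOn_iff_integrable_of_support_subset fun x hx => ?_).1 h1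
      by_contra h
      exact hx (by simp [h0 x h])
    have hSz : ∀ x ∉ K, steklov Y v t x = 0 := fun x hx =>
      steklov_eq_zero_of_notMem_cthickening ht htδ hx
    have hYcont := hY.continuous
    have := integral_bilinear_hasLineDerivAt_right_eq_neg_left_of_integrable (μ := μ)
      (f := u) (f' := fun x => fderiv ℝ u x v) (g := steklov Y v t)
      (g' := fun x => t⁻¹ * (Y (x + t • v) - Y x)) (v := v)
      (B := ContinuousLinearMap.mul ℝ ℝ)
      (hmul_int hdK (continuous_steklov hY.continuous v t) hSz)
      (hmul_int huK (by fun_prop) fun x hx => by rw [hquot t ht htδ x hx, mul_zero])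
      (hmul_int huK (continuous_steklov hY.continuous v t) hSz)
      (fun x hx => (hu x (hKV (hsupp hx))).hasFDerivAt.hasLineDerivAt v)
      (fun x _ => hasLineDerivAt_steklov hY.continuous v t x)
    simp only [ContinuousLinearMap.mul_apply'] at this
    rw [← this]
    refine integral_congr_ae (.of_forall fun x => ?_)
    by_cases hx : x ∈ K
    · simp only [indicator_of_mem hx, smul_eq_mul]
      ring
    · simp [hquot t ht htδ x hx]
  have := tendsto_nhds_unique (hlim1.congr' heq) hlim2
  rw [← this]
  refine integral_congr_ae (.of_forall fun x => ?_)
  by_cases hx : x ∈ K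
  · simp only [indicator_of_mem hx]
    ring
  · have h0 : lineDeriv ℝ Y x v = 0 := by
      have : Y =ᶠ[𝓝 x] fun _ => 0 := notMem_tsupport_iff_eventuallyEq.1 fun h => hx (hYK h)
      rw [this.lineDeriv_eq]
      simp [lineDeriv]
    simp [h0]

end IntegrationByParts

section Distance

lemma norm_fderiv_infDist_eq_one {E : Type*} [NormedAddCommGroup E] [NormedSpace ℝ E]
    [ProperSpace E] {A : Set E} (hA : A.Nonempty) {x : E} (hx : x ∉ closure A)
    (hd : DifferentiableAt ℝ (fun y => Metric.infDist y A) x) :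
    ‖fderiv ℝ (fun y => Metric.infDist y A) x‖ = 1 := by
  refine le_antisymm ?_ ?_
  · simpa using norm_fderiv_le_of_lipschitz ℝ (Metric.lipschitz_infDist_pt A) (x₀ := x)
  obtain ⟨y, hy, hxy⟩ := Metric.exists_mem_closure_infDist_eq_dist hA x
  have hv : 0 < ‖y - x‖ := by
    rw [norm_pos_iff, sub_ne_zero]
    rintro rfl
    exact hx hy
  have hslope := (hd.hasFDerivAt.hasLineDerivAt (y - x)).tendsto_slope_zero_right
  have hle : fderiv ℝ (fun y => Metric.infDist y A) x (y - x) ≤ -‖y - x‖ := by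
    refine le_of_tendsto hslope ?_
    have h1 : ∀ᶠ t in 𝓝[>] (0 : ℝ), 0 < t := eventually_mem_nhdsWithin
    have h2 : ∀ᶠ t in 𝓝[>] (0 : ℝ), t < 1 :=
      mem_nhdsWithin_of_mem_nhds (Iio_mem_nhds one_pos)
    filter_upwards [h1, h2] with t ht ht1
    have h3 : Metric.infDist (x + t • (y - x)) A ≤ (1 - t) * ‖y - x‖ := by
      rw [← Metric.infDist_closure]
      refine (Metric.infDist_le_dist_of_mem hy).trans_eq ?_
      rw [dist_eq_norm', show y - (x + t • (y - x)) = (1 - t) • (y - x) by module, norm_smul,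
        Real.norm_eq_abs, abs_of_pos (by linarith)]
    rw [smul_eq_mul, inv_mul_le_iff₀ ht, hxy, dist_eq_norm' x y]
    linarith
  have h4 := (fderiv ℝ (fun y => Metric.infDist y A) x).le_opNorm (y - x)
  rw [Real.norm_eq_abs] at h4
  have h5 := neg_le_abs (fderiv ℝ (fun y => Metric.infDist y A) x (y - x))
  by_contra! hlt
  nlinarith

end Distance

section LipschitzLemmas

lemma LipschitzWith.mul_of_bounded {α : Type*} [PseudoMetricSpace α] {f g : α → ℝ} {A B : NNReal}
    (hf : LipschitzWith A f) (hg : LipschitzWith B g) {M N : NNReal} (hM : ∀ x, |f x| ≤ M)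
    (hN : ∀ x, |g x| ≤ N) : LipschitzWith (A * N + M * B) fun x => f x * g x := by
  refine LipschitzWith.of_dist_le_mul fun x y => ?_
  have h1 := hf.dist_le_mul x y
  have h2 := hg.dist_le_mul x y
  rw [Real.dist_eq] at *
  calc |f x * g x - f y * g y| = |(f x - f y) * g x + f y * (g x - g y)| := by ring_nf
    _ ≤ |f x - f y| * |g x| + |f y| * |g x - g y| := by
      rw [← abs_mul, ← abs_mul]; exact abs_add_le _ _
    _ ≤ (A * dist x y) * N + M * (B * dist x y) := by
      gcongr
      · exact hN x
      · exact hM y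
    _ = _ := by push_cast; ring

variable {E : Type*} [NormedAddCommGroup E] [NormedSpace ℝ E] [FiniteDimensional ℝ E]
  [MeasurableSpace E] [BorelSpace E] {μ : Measure E} [μ.IsAddHaarMeasure]

lemma LipschitzWith.ae_fderiv_eq_zero_of_eq {d : E → ℝ} {C : NNReal} (hd : LipschitzWith C d)
    (c : ℝ) : ∀ᵐ x ∂μ, d x = c → fderiv ℝ d x = 0 := by
  have habs : LipschitzWith C fun x => |d x - c| := by
    refine LipschitzWith.of_dist_le_mul fun x y => ?_
    refine le_trans ?_ (hd.dist_le_mul x y)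
    rw [Real.dist_eq, Real.dist_eq]
    refine (abs_abs_sub_abs_le _ _).trans_eq ?_
    ring_nf
  filter_upwards [habs.ae_differentiableAt (μ := μ)] with x hx hxc
  have hmin : IsLocalMin (fun x => |d x - c|) x :=
    .of_forall fun y => by simp [hxc]
  have h0 : HasFDerivAt (fun x => |d x - c|) (0 : E →L[ℝ] ℝ) x := by
    rw [← hmin.fderiv_eq_zero]
    exact hx.hasFDerivAt
  refine HasFDerivAt.fderiv ?_
  rw [hasFDerivAt_iff_isLittleO] at h0 ⊢
  simpa [hxc] using h0

end LipschitzLemmas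

lemma integrable_mul_of_bounded_of_support {α : Type*} [MeasurableSpace α] {μ : Measure α}
    {K : Set α} {a b : α → ℝ} (ha : IntegrableOn a K μ) (hb : Measurable b) {M : ℝ}
    (hM : ∀ x, |b x| ≤ M) (h0 : ∀ x ∉ K, b x = 0) : Integrable (fun x => a x * b x) μ := by
  refine (integrableOn_iff_integrable_of_support_subset (s := K) fun x hx => ?_).1
    (Integrable.mul_bdd ha hb.aestronglyMeasurable (.of_forall hM))
  by_contra h
  exact hx (by simp [h0 x h])

section Shell

variable {n : ℕ}

/-- The divergence of the field with components `g i`. -/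
def divergence (g : Fin n → EuclideanSpace ℝ (Fin n) → ℝ) (x : EuclideanSpace ℝ (Fin n)) : ℝ :=
  ∑ i, lineDeriv ℝ (g i) x (EuclideanSpace.single i 1)

/-- `g` is a bounded Lipschitz field that is the gradient of `d`, and has unit length, on the
compact shell `{|d| ≤ r}`. -/
structure IsShellNormal (d : EuclideanSpace ℝ (Fin n) → ℝ) (r : ℝ)
    (g : Fin n → EuclideanSpace ℝ (Fin n) → ℝ) : Prop where
  lipschitz_dist : ∃ C, LipschitzWith C d
  isCompact_shell : IsCompact {x | |d x| ≤ r}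
  lipschitz : ∃ L, ∀ i, LipschitzWith L (g i)
  abs_component_le : ∀ i x, |g i x| ≤ 1
  fderiv_eq : ∀ i x, |d x| ≤ r → fderiv ℝ d x (EuclideanSpace.single i 1) = g i x
  sum_sq : ∀ x, |d x| ≤ r → ∑ i, g i x ^ 2 = 1

variable {d : EuclideanSpace ℝ (Fin n) → ℝ} {r : ℝ} {g : Fin n → EuclideanSpace ℝ (Fin n) → ℝ}

lemma measurable_divergence (hL : ∃ L, ∀ i, LipschitzWith L (g i)) :
    Measurable (divergence g) := by
  obtain ⟨L, hL⟩ := hL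
  unfold divergence
  exact Finset.measurable_sum _ fun i _ => measurable_lineDeriv (hL i).continuous

lemma exists_abs_divergence_le (hL : ∃ L, ∀ i, LipschitzWith L (g i)) :
    ∃ A, 0 ≤ A ∧ ∀ x, |divergence g x| ≤ A := by
  obtain ⟨L, hL⟩ := hL
  refine ⟨n * L, by positivity, fun x => ?_⟩
  refine (Finset.abs_sum_le_sum_abs _ _).trans ?_
  refine (Finset.sum_le_card_nsmul _ _ (L : ℝ) fun i _ => ?_).trans_eq (by simp)
  simpa using norm_lineDeriv_le_of_lipschitz ℝ (hL i) (x₀ := x)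
    (v := EuclideanSpace.single i (1 : ℝ))

/-- Divergence theorem for the field `φ(d) ∇d`, tested against a Sobolev function. -/
lemma IsShellNormal.integral_mul_div (H : IsShellNormal d r g) {φ : ℝ → ℝ} {C : NNReal}
    (hφ : LipschitzWith C φ) {s : ℝ} (hsr : s ≤ r) (hφs : ∀ t, s ≤ |t| → φ t = 0) {Z : Set ℝ}
    (hZ : Z.Countable) (hφZ : ∀ t ∉ Z, DifferentiableAt ℝ φ t)
    {V : Set (EuclideanSpace ℝ (Fin n))} (hV : IsOpen V) (hKV : {x | |d x| ≤ s} ⊆ V)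
    {h : EuclideanSpace ℝ (Fin n) → ℝ} (hd : ∀ x ∈ V, DifferentiableAt ℝ h x)
    (hi : LocallyIntegrableOn h V) (hdi : LocallyIntegrableOn (fderiv ℝ h) V) :
    ∫ x, h x * (deriv φ (d x) + φ (d x) * divergence g x) =
      -∫ x, φ (d x) * ∑ i, g i x * fderiv ℝ h x (EuclideanSpace.single i 1) := by
  obtain ⟨Cd, hdL⟩ := H.lipschitz_dist
  obtain ⟨L, hgL⟩ := H.lipschitz
  have hdc := hdL.continuous
  have hKcl : IsClosed {x | |d x| ≤ s} := isClosed_le (by fun_prop) continuous_const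
  have hKc : IsCompact {x | |d x| ≤ s} :=
    H.isCompact_shell.of_isClosed_subset hKcl fun x (hx : |d x| ≤ s) => hx.trans hsr
  set K := {x | |d x| ≤ s}
  obtain ⟨M, hM⟩ : ∃ M : NNReal, ∀ x, |φ x| ≤ M := by
    have hc : HasCompactSupport φ := by
      refine HasCompactSupport.intro (isCompact_Icc (a := -s) (b := s)) fun t ht => hφs t ?_
      by_contra hlt
      exact ht (abs_le.1 (not_le.1 hlt).le)
    obtain ⟨M, hM⟩ := hφ.continuous.bounded_above_of_compact_support hc
    exact ⟨M.toNNReal, fun x => (hM x).trans (Real.le_coe_toNNReal M)⟩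
  set Y : Fin n → EuclideanSpace ℝ (Fin n) → ℝ := fun i x => φ (d x) * g i x with hYdef
  have hY i : LipschitzWith (C * Cd * 1 + M * L) (Y i) :=
    (hφ.comp hdL).mul_of_bounded (hgL i) (fun x => hM _) (fun x => by simpa using H.abs_component_le i x)
  have hYsupp i : tsupport (Y i) ⊆ K := by
    refine closure_minimal (fun x hx => ?_) hKcl
    by_contra hxK
    exact hx (by simp [Y, hφs (d x) (not_le.1 hxK).le])
  have hY0 i : ∀ x ∉ K, Y i x = 0 := fun x hx =>
    image_eq_zero_of_notMem_tsupport fun h => hx (hYsupp i h)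
  have hYd0 i : ∀ x ∉ K, lineDeriv ℝ (Y i) x (EuclideanSpace.single i 1) = 0 := by
    intro x hx
    have : Y i =ᶠ[𝓝 x] fun _ => 0 :=
      notMem_tsupport_iff_eventuallyEq.1 fun h => hx (hYsupp i h)
    rw [this.lineDeriv_eq]
    simp [lineDeriv]
  have hYc i : HasCompactSupport (Y i) := hKc.of_isClosed_subset (isClosed_tsupport _) (hYsupp i)
  have hhK : IntegrableOn h K := hi.integrableOn_compact_subset hKV hKc
  have hdK : IntegrableOn (fderiv ℝ h) K := hdi.integrableOn_compact_subset hKV hKc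
  have hparts i := integral_mul_lineDeriv_eq_neg_of_lipschitzWith hV hd hi hdi (hY i) (hYc i)
    ((hYsupp i).trans hKV) (EuclideanSpace.single i (1 : ℝ))
  have hF_int i : Integrable fun x => h x * lineDeriv ℝ (Y i) x (EuclideanSpace.single i 1) :=
    integrable_mul_of_bounded_of_support hhK (measurable_lineDeriv (hY i).continuous)
      (fun x => norm_lineDeriv_le_of_lipschitz ℝ (hY i)) (hYd0 i)
  have hG_int i : Integrable fun x => fderiv ℝ h x (EuclideanSpace.single i 1) * Y i x := by
    obtain ⟨B, hB⟩ := (hY i).continuous.bounded_above_of_compact_support (hYc i)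
    exact integrable_mul_of_bounded_of_support (hdK.apply_continuousLinearMap _)
      (hY i).continuous.measurable hB (hY0 i)
  have hae : ∀ᵐ x, deriv φ (d x) + φ (d x) * divergence g x =
      ∑ i, lineDeriv ℝ (Y i) x (EuclideanSpace.single i 1) := by
    have h1 : ∀ᵐ x, ∀ i, DifferentiableAt ℝ (g i) x :=
      ae_all_iff.2 fun i => (hgL i).ae_differentiableAt
    have h2 : ∀ᵐ x, ∀ c ∈ Z, d x = c → fderiv ℝ d x = 0 :=
      (ae_ball_iff hZ).2 fun c _ => hdL.ae_fderiv_eq_zero_of_eq c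
    filter_upwards [h1, h2, hdL.ae_differentiableAt] with x hgx hzx hdx
    by_cases hxr : |d x| ≤ r
    · have hdZ : d x ∉ Z := by
        intro hmem
        have h0 := hzx _ hmem rfl
        have h3 := H.sum_sq x hxr
        simp [← H.fderiv_eq _ x hxr, h0] at h3
      have hcomp := ((hφZ _ hdZ).hasDerivAt.comp_hasFDerivAt x hdx.hasFDerivAt)
      have hline i : lineDeriv ℝ (Y i) x (EuclideanSpace.single i 1) =
          deriv φ (d x) * g i x ^ 2 +
            φ (d x) * lineDeriv ℝ (g i) x (EuclideanSpace.single i 1) := by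
        have h5 := (hcomp.mul (hgx i).hasFDerivAt).hasLineDerivAt (EuclideanSpace.single i 1)
        have h6 := h5.lineDeriv
        rw [(hgx i).lineDeriv_eq_fderiv]
        simp only [_root_.add_apply, _root_.smul_apply,
          smul_eq_mul, H.fderiv_eq i x hxr, Function.comp_apply] at h6
        refine Eq.trans h6 ?_
        ring
      simp_rw [hline]
      rw [Finset.sum_add_distrib, ← Finset.mul_sum, ← Finset.mul_sum, H.sum_sq x hxr, mul_one]
      rfl
    · have hxs : s < |d x| := hsr.trans_lt (not_le.1 hxr)
      have hev : φ =ᶠ[𝓝 (d x)] fun _ => 0 := by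
        have : ∀ᶠ t in 𝓝 (d x), s < |t| :=
          (continuous_abs.tendsto (d x)).eventually (lt_mem_nhds hxs)
        filter_upwards [this] with t ht using hφs t ht.le
      rw [hev.deriv_eq, hev.eq_of_nhds]
      simp [hYd0 _ x (not_le.2 hxs)]
  calc ∫ x, h x * (deriv φ (d x) + φ (d x) * divergence g x)
      = ∫ x, ∑ i, h x * lineDeriv ℝ (Y i) x (EuclideanSpace.single i 1) := by
        refine integral_congr_ae ?_
        filter_upwards [hae] with x hx
        rw [hx, Finset.mul_sum]
    _ = -∑ i, ∫ x, fderiv ℝ h x (EuclideanSpace.single i 1) * Y i x := by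
        rw [integral_finsetSum _ fun i _ => hF_int i, ← Finset.sum_neg_distrib]
        exact Finset.sum_congr rfl fun i _ => hparts i
    _ = _ := by
        rw [← integral_finsetSum _ fun i _ => hG_int i]
        congr 1
        refine integral_congr_ae (.of_forall fun x => ?_)
        simp only [Finset.mul_sum, Y]
        exact Finset.sum_congr rfl fun i _ => by ring

end Shell

section ShellVolume

/-- A Lipschitz bump rising with slope `1` on `(-ε, ε)` and decaying slowly to `0` at `r`. -/
def ramp (ε r t : ℝ) : ℝ := max 0 (min (t + ε) (4 * ε / r * (r - t)))

variable {ε r : ℝ}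

lemma ramp_eq_zero (hε : 0 < ε) (hεr : ε ≤ r / 2) {t : ℝ} (ht : r ≤ |t|) : ramp ε r t = 0 := by
  have hr : 0 < r := by linarith
  refine max_eq_left ?_
  rcases le_abs.1 ht with h | h
  · exact (min_le_right _ _).trans
      (mul_nonpos_of_nonneg_of_nonpos (by positivity) (by linarith))
  · exact (min_le_left _ _).trans (by linarith)

lemma ramp_nonneg (t : ℝ) : 0 ≤ ramp ε r t := le_max_left _ _

lemma ramp_le (hε : 0 < ε) (hεr : ε ≤ r / 2) (t : ℝ) : ramp ε r t ≤ 8 * ε := by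
  have hr : 0 < r := by linarith
  rcases le_total r |t| with h | h
  · rw [ramp_eq_zero hε hεr h]; positivity
  · refine max_le (by positivity) ((min_le_right _ _).trans ?_)
    have : r - t ≤ 2 * r := by linarith [(abs_le.1 h).1]
    calc 4 * ε / r * (r - t) ≤ 4 * ε / r * (2 * r) := by gcongr
      _ = 8 * ε := by field_simp; ring

lemma lipschitzWith_ramp (hε : 0 < ε) (hεr : ε ≤ r / 2) : LipschitzWith 2 (ramp ε r) := by
  have hr : 0 < r := by linarith
  have hκ : 4 * ε / r ≤ 2 := by rw [div_le_iff₀ hr]; linarith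
  have h1 : LipschitzWith 2 fun t : ℝ => t + ε :=
    LipschitzWith.of_dist_le_mul fun x y => by
      rw [dist_add_right]
      push_cast
      linarith [dist_nonneg (x := x) (y := y)]
  have h2 : LipschitzWith 2 fun t : ℝ => 4 * ε / r * (r - t) :=
    LipschitzWith.of_dist_le_mul fun x y => by
      rw [Real.dist_eq, ← mul_sub, abs_mul, abs_of_pos (by positivity : 0 < 4 * ε / r),
        Real.dist_eq, show r - x - (r - y) = -(x - y) by ring, abs_neg]
      push_cast
      gcongr
  have h := (h1.min h2).const_max 0
  rwa [max_self] at h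

lemma monotone_ramp_add (hε : 0 < ε) (hεr : ε ≤ r / 2) :
    Monotone fun t => ramp ε r t + 4 * ε / r * t := by
  have hr : 0 < r := by linarith
  have hκ : 0 < 4 * ε / r := by positivity
  intro x y hxy
  have h1 : 4 * ε / r * x ≤ 4 * ε / r * y := by gcongr
  simp only [ramp, ← max_add_add_right, ← min_add_add_right]
  refine max_le_max (by linarith) (min_le_min (by linarith) (le_of_eq (by ring)))

lemma neg_le_deriv_ramp (hε : 0 < ε) (hεr : ε ≤ r / 2) (t : ℝ) :
    -(4 * ε / r) ≤ deriv (ramp ε r) t := by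
  have hr : 0 < r := by linarith
  have hκ : 0 < 4 * ε / r := by positivity
  by_cases h : DifferentiableAt ℝ (ramp ε r) t
  · have h1 := (h.hasDerivAt.add ((hasDerivAt_id t).const_mul (4 * ε / r))).deriv
    have h2 : 0 ≤ deriv (fun t => ramp ε r t + 4 * ε / r * t) t :=
      (monotone_ramp_add hε hεr).deriv_nonneg
    have h3 : (ramp ε r + fun t => 4 * ε / r * id t) = fun t => ramp ε r t + 4 * ε / r * t := rfl
    rw [h3] at h1
    linarith
  · rw [deriv_zero_of_not_differentiableAt h]
    linarith

lemma hasDerivAt_ramp_of_between {t : ℝ} (h1 : -ε < t)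
    (h2 : t + ε < 4 * ε / r * (r - t)) : HasDerivAt (ramp ε r) 1 t := by
  have hev : ramp ε r =ᶠ[𝓝 t] fun t => t + ε := by
    have e1 : ∀ᶠ y in 𝓝 t, -ε < y := lt_mem_nhds h1
    have e2 : ∀ᶠ y in 𝓝 t, y + ε < 4 * ε / r * (r - y) :=
      (isOpen_lt (by fun_prop : Continuous fun y : ℝ => y + ε)
        (by fun_prop : Continuous fun y : ℝ => 4 * ε / r * (r - y))).mem_nhds h2
    filter_upwards [e1, e2] with y hy1 hy2
    rw [ramp, min_eq_left hy2.le, max_eq_right (by linarith)]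
  exact ((hasDerivAt_id t).add_const ε).congr_of_eventuallyEq hev

lemma deriv_ramp_eq_one (hε : 0 < ε) (hεr : ε ≤ r / 2) {t : ℝ} (ht : |t| < ε) :
    deriv (ramp ε r) t = 1 := by
  have hr : 0 < r := by linarith
  refine (hasDerivAt_ramp_of_between (abs_lt.1 ht).1 ?_).deriv
  have h1 : t < ε := (abs_lt.1 ht).2
  have h2 : r / 2 < r - t := by linarith
  calc t + ε < 2 * ε := by linarith
    _ = 4 * ε / r * (r / 2) := by field_simp; ring
    _ < 4 * ε / r * (r - t) := by gcongr

lemma deriv_ramp_eq_zero (hε : 0 < ε) (hεr : ε ≤ r / 2) {t : ℝ} (ht : r < |t|) :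
    deriv (ramp ε r) t = 0 := by
  have hev : ramp ε r =ᶠ[𝓝 t] fun _ => 0 := by
    have : ∀ᶠ y in 𝓝 t, r < |y| := (continuous_abs.tendsto t).eventually (lt_mem_nhds ht)
    filter_upwards [this] with y hy using ramp_eq_zero hε hεr hy.le
  rw [hev.deriv_eq, deriv_const]

lemma exists_countable_differentiableAt_ramp (hε : 0 < ε) (hεr : ε ≤ r / 2) :
    ∃ Z : Set ℝ, Z.Countable ∧ ∀ t ∉ Z, DifferentiableAt ℝ (ramp ε r) t := by
  have hr : 0 < r := by linarith
  have hκ : 0 < 4 * ε / r := by positivity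
  refine ⟨{-ε, r, (4 * ε / r * r - ε) / (1 + 4 * ε / r)}, (Set.toFinite _).countable, ?_⟩
  intro t ht
  simp only [mem_insert_iff, mem_singleton_iff, not_or] at ht
  obtain ⟨h1, h2, h3⟩ := ht
  rw [_root_.eq_div_iff (by positivity)] at h3
  have c1 : Continuous fun y : ℝ => y + ε := by fun_prop
  have c2 : Continuous fun y : ℝ => 4 * ε / r * (r - y) := by fun_prop
  rcases lt_or_gt_of_ne h1 with h | h
  · have hev : ramp ε r =ᶠ[𝓝 t] fun _ => 0 := by
      filter_upwards [gt_mem_nhds h] with y hy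
      exact max_eq_left ((min_le_left _ _).trans (by linarith))
    exact (differentiableAt_const _).congr_of_eventuallyEq hev
  rcases lt_or_gt_of_ne h2 with h' | h'
  · rcases lt_trichotomy (t + ε) (4 * ε / r * (r - t)) with h4 | h4 | h4
    · exact (hasDerivAt_ramp_of_between h h4).differentiableAt
    · exact absurd (by linarith) h3
    · have hev : ramp ε r =ᶠ[𝓝 t] fun t => 4 * ε / r * (r - t) := by
        filter_upwards [gt_mem_nhds h', (isOpen_lt c2 c1).mem_nhds h4] with y hy1 hy2
        rw [ramp, min_eq_right hy2.le, max_eq_right (mul_nonneg hκ.le (by linarith))]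
      have hdiff : DifferentiableAt ℝ (fun t : ℝ => 4 * ε / r * (r - t)) t := by fun_prop
      exact hdiff.congr_of_eventuallyEq hev
  · have hev : ramp ε r =ᶠ[𝓝 t] fun _ => 0 := by
      filter_upwards [lt_mem_nhds h'] with y hy
      exact max_eq_left ((min_le_right _ _).trans
        (mul_nonpos_of_nonneg_of_nonpos hκ.le (by linarith)))
    exact (differentiableAt_const _).congr_of_eventuallyEq hev

variable {n : ℕ} {d : EuclideanSpace ℝ (Fin n) → ℝ} {g : Fin n → EuclideanSpace ℝ (Fin n) → ℝ}

/-- The volume of the shell `{|d| < ε}` is at most proportional to `ε`. -/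
lemma IsShellNormal.exists_volume_le (H : IsShellNormal d r g) (hr : 0 < r) :
    ∃ C, 0 ≤ C ∧ ∀ ε, 0 < ε → ε ≤ r / 2 → volume.real {x | |d x| < ε} ≤ C * ε := by
  obtain ⟨Cd, hdL⟩ := H.lipschitz_dist
  have hdc := hdL.continuous
  obtain ⟨A, hA0, hA⟩ := exists_abs_divergence_le H.lipschitz
  have hKc := H.isCompact_shell
  set K := {x | |d x| ≤ r} with hK
  have hKfin : volume K ≠ ⊤ := hKc.measure_lt_top.ne
  refine ⟨(4 / r + 8 * A) * volume.real K, by positivity, fun ε hε hεr => ?_⟩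
  obtain ⟨Z, hZ, hZd⟩ := exists_countable_differentiableAt_ramp hε hεr
  have key := H.integral_mul_div (lipschitzWith_ramp hε hεr) le_rfl
    (fun t ht => ramp_eq_zero hε hεr ht) hZ hZd isOpen_univ (subset_univ _)
    (h := fun _ => (1 : ℝ)) (fun x _ => differentiableAt_const _)
    ((continuous_const.locallyIntegrable).locallyIntegrableOn _)
    (by
      rw [fderiv_fun_const]
      exact (locallyIntegrable_const (0 : EuclideanSpace ℝ (Fin n) →L[ℝ] ℝ)).locallyIntegrableOn _)
  simp only [fderiv_fun_const, Pi.zero_apply, _root_.zero_apply, mul_zero,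
    Finset.sum_const_zero, integral_zero, neg_zero] at key
  set b : EuclideanSpace ℝ (Fin n) → ℝ :=
    fun x => deriv (ramp ε r) (d x) + ramp ε r (d x) * divergence g x with hb
  have hprod x : |ramp ε r (d x) * divergence g x| ≤ 8 * ε * A := by
    rw [abs_mul, abs_of_nonneg (ramp_nonneg _)]
    gcongr
    · exact ramp_le hε hεr _
    · exact hA x
  have hb0 : ∀ x ∉ K, b x = 0 := fun x hx => by
    have hx : r < |d x| := not_le.1 hx
    simp [b, deriv_ramp_eq_zero hε hεr hx, ramp_eq_zero hε hεr hx.le]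
  have hbm : Measurable b := by
    refine ((measurable_deriv _).comp hdc.measurable).add (Measurable.mul ?_
      (measurable_divergence H.lipschitz))
    exact (lipschitzWith_ramp hε hεr).continuous.measurable.comp hdc.measurable
  have hbi : Integrable fun x => (1 : ℝ) * b x := by
    refine integrable_mul_of_bounded_of_support (K := K) (M := 2 + 8 * ε * A)
      (integrableOn_const hKfin) hbm (fun x => ?_) hb0
    refine (abs_add_le _ _).trans (add_le_add ?_ (hprod x))
    simpa using norm_deriv_le_of_lipschitz (lipschitzWith_ramp hε hεr) (x₀ := d x)
  have hNm : MeasurableSet {x | |d x| < ε} := (isOpen_lt (by fun_prop) continuous_const).measurableSet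
  have hNK : {x | |d x| < ε} ⊆ K := fun x (hx : |d x| < ε) =>
    show |d x| ≤ r by linarith
  have hNfin : volume {x | |d x| < ε} ≠ ⊤ := measure_ne_top_of_subset hNK hKfin
  have hci : Integrable (K.indicator fun _ => 4 * ε / r + 8 * ε * A) :=
    (integrable_indicator_iff hKc.measurableSet).2 (integrableOn_const hKfin)
  calc volume.real {x | |d x| < ε}
      = ∫ x, {x | |d x| < ε}.indicator (fun _ => (1 : ℝ)) x := by
        rw [integral_indicator hNm]; simp
    _ ≤ ∫ x, ((1 : ℝ) * b x + K.indicator (fun _ => 4 * ε / r + 8 * ε * A) x) := by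
        refine integral_mono ((integrable_indicator_iff hNm).2 (integrableOn_const hNfin))
          (hbi.add hci) fun x => ?_
        have hp := neg_abs_le (ramp ε r (d x) * divergence g x)
        have hp' := hprod x
        have hκ : 0 < 4 * ε / r := by positivity
        by_cases hxN : x ∈ {x | |d x| < ε}
        · rw [indicator_of_mem hxN, indicator_of_mem (hNK hxN)]
          simp only [b, deriv_ramp_eq_one hε hεr hxN]
          linarith
        · rw [indicator_of_notMem hxN]
          by_cases hxK : x ∈ K
          · rw [indicator_of_mem hxK]
            have := neg_le_deriv_ramp hε hεr (d x)
            simp only [b]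
            linarith
          · simp [indicator_of_notMem hxK, hb0 x hxK]
    _ = (4 / r + 8 * A) * volume.real K * ε := by
        rw [integral_add hbi hci, key, integral_indicator hKc.measurableSet, setIntegral_const,
          smul_eq_mul]
        ring

end ShellVolume

section Profile

/-- The properties of the transition profile `W(t) = (1 + S(-t/ε))/2` that enter the estimates. -/
structure IsProfile (W : ℝ → ℝ) (ε : ℝ) : Prop where
  continuous : Continuous W
  antitone : Antitone W
  map_neg : ∀ t, W (-t) = 1 - W t
  nonneg : ∀ t, 0 ≤ W t
  pos : ∀ t, t < ε → 0 < W t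

/-- The difference between a transition profile and the sharp transition. -/
def profileDefect (W : ℝ → ℝ) (t : ℝ) : ℝ := W t - (Iio (0 : ℝ)).indicator 1 t

/-- The even primitive of `-profileDefect W` vanishing outside `(-s, s)`. -/
def profilePrimitive (W : ℝ → ℝ) (s t : ℝ) : ℝ := ∫ τ in (min |t| s)..s, W τ

variable {W : ℝ → ℝ} {ε s : ℝ}

lemma IsProfile.le_one (H : IsProfile W ε) (t : ℝ) : W t ≤ 1 := by
  have := H.nonneg (-t)
  rw [H.map_neg] at this
  linarith

lemma IsProfile.measurable_profileDefect (H : IsProfile W ε) : Measurable (profileDefect W) :=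
  H.continuous.measurable.sub (measurable_one.indicator measurableSet_Iio)

lemma IsProfile.abs_profileDefect_le (H : IsProfile W ε) (t : ℝ) : |profileDefect W t| ≤ W t := by
  unfold profileDefect
  by_cases ht : t < 0
  · have h1 := H.antitone (show t ≤ -t by linarith)
    have h2 := H.le_one t
    rw [H.map_neg] at h1
    rw [indicator_of_mem (show t ∈ Iio 0 from ht), Pi.one_apply, abs_of_nonpos (by linarith)]
    linarith
  · rw [indicator_of_notMem (by simpa using ht), sub_zero, abs_of_nonneg (H.nonneg t)]

lemma profilePrimitive_eq_zero {t : ℝ} (ht : s ≤ |t|) : profilePrimitive W s t = 0 := by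
  simp [profilePrimitive, min_eq_right ht]

lemma IsProfile.abs_profilePrimitive_le (H : IsProfile W ε) (hs : 0 ≤ s) (t : ℝ) :
    |profilePrimitive W s t| ≤ s * W t := by
  rcases le_total s |t| with h | h
  · rw [profilePrimitive_eq_zero h, abs_zero]
    exact mul_nonneg hs (H.nonneg t)
  · rw [profilePrimitive, min_eq_left h]
    have h1 : ‖∫ τ in |t|..s, W τ‖ ≤ W t * |s - (|t|)| := by
      refine intervalIntegral.norm_integral_le_of_norm_le_const fun τ hτ => ?_
      rw [uIoc_of_le h] at hτ
      rw [Real.norm_eq_abs, abs_of_nonneg (H.nonneg τ)]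
      exact H.antitone ((le_abs_self t).trans hτ.1.le)
    refine h1.trans ?_
    rw [mul_comm]
    refine mul_le_mul_of_nonneg_right ?_ (H.nonneg t)
    rw [abs_of_nonneg (by linarith)]
    linarith [abs_nonneg t]

lemma IsProfile.lipschitzWith_profilePrimitive (H : IsProfile W ε) (s : ℝ) :
    LipschitzWith 1 (profilePrimitive W s) := by
  refine LipschitzWith.of_dist_le_mul fun x y => ?_
  have hi a b : IntervalIntegrable W volume a b := H.continuous.intervalIntegrable a b
  rw [Real.dist_eq, profilePrimitive, profilePrimitive,
    intervalIntegral.integral_interval_sub_interval_comm (hi _ _) (hi _ _) (hi _ _),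
    intervalIntegral.integral_same, sub_zero]
  have h1 : ‖∫ τ in (min |x| s)..(min |y| s), W τ‖ ≤ 1 * |min |y| s - min |x| s| :=
    intervalIntegral.norm_integral_le_of_norm_le_const fun τ _ => by
      rw [Real.norm_eq_abs, abs_of_nonneg (H.nonneg τ)]
      exact H.le_one τ
  refine h1.trans ?_
  rw [NNReal.coe_one, one_mul, one_mul, dist_comm, Real.dist_eq]
  have h2 : |min |y| s - min |x| s| ≤ max |(|y| - |x|)| |s - s| :=
    abs_min_sub_min_le_max _ _ _ _
  rw [sub_self, abs_zero, max_eq_left (abs_nonneg _)] at h2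
  exact h2.trans (abs_abs_sub_abs_le _ _)

lemma IsProfile.hasDerivAt_profilePrimitive (H : IsProfile W ε) {t : ℝ} (h0 : t ≠ 0)
    (hs : |t| < s) : HasDerivAt (profilePrimitive W s) (-profileDefect W t) t := by
  have hF (u : ℝ) : HasDerivAt (fun u => ∫ τ in u..s, W τ) (-W u) u :=
    intervalIntegral.integral_hasDerivAt_left (H.continuous.intervalIntegrable _ _)
      (H.continuous.stronglyMeasurableAtFilter _ _) H.continuous.continuousAt
  have hev : ∀ᶠ y in 𝓝 t, |y| < s := (continuous_abs.tendsto t).eventually (gt_mem_nhds hs)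
  rcases lt_or_gt_of_ne h0 with h | h
  · have heq : profilePrimitive W s =ᶠ[𝓝 t] (fun u => ∫ τ in u..s, W τ) ∘ fun y => -y := by
      filter_upwards [hev, gt_mem_nhds h] with y hy hy0
      rw [profilePrimitive, min_eq_left hy.le, abs_of_neg hy0]
      rfl
    refine HasDerivAt.congr_of_eventuallyEq ?_ heq
    have hval : -profileDefect W t = -W (-t) * -1 := by
      simp only [profileDefect]
      rw [indicator_of_mem (show t ∈ Iio 0 from h), H.map_neg, Pi.one_apply]
      ring
    rw [hval]
    exact (hF (-t)).comp t (hasDerivAt_neg t)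
  · have heq : profilePrimitive W s =ᶠ[𝓝 t] fun u => ∫ τ in u..s, W τ := by
      filter_upwards [hev, lt_mem_nhds h] with y hy hy0
      rw [profilePrimitive, min_eq_left hy.le, abs_of_pos hy0]
    refine HasDerivAt.congr_of_eventuallyEq ?_ heq
    have hval : -profileDefect W t = -W t := by
      simp only [profileDefect]
      rw [indicator_of_notMem (by simpa using h.le), sub_zero]
    rw [hval]
    exact hF t

lemma hasDerivAt_profilePrimitive_of_lt {t : ℝ} (hs : s < |t|) :
    HasDerivAt (profilePrimitive W s) 0 t := by
  refine (hasDerivAt_const t (0 : ℝ)).congr_of_eventuallyEq ?_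
  have : ∀ᶠ y in 𝓝 t, s < |y| := (continuous_abs.tendsto t).eventually (lt_mem_nhds hs)
  filter_upwards [this] with y hy using profilePrimitive_eq_zero hy.le

lemma IsProfile.exists_countable_differentiableAt (H : IsProfile W ε) (s : ℝ) :
    ∃ Z : Set ℝ, Z.Countable ∧ ∀ t ∉ Z, DifferentiableAt ℝ (profilePrimitive W s) t := by
  refine ⟨{0, s, -s}, (Set.toFinite _).countable, fun t ht => ?_⟩
  simp only [mem_insert_iff, mem_singleton_iff, not_or] at ht
  obtain ⟨h1, h2, h3⟩ := ht
  rcases lt_trichotomy |t| s with h | h | h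
  · exact (H.hasDerivAt_profilePrimitive h1 h).differentiableAt
  · rcases abs_choice t with h' | h'
    · exact absurd (h'.symm.trans h) h2
    · exact absurd (by linarith) h3
  · exact (hasDerivAt_profilePrimitive_of_lt h).differentiableAt

variable {n : ℕ} {d : EuclideanSpace ℝ (Fin n) → ℝ} {r : ℝ}
  {g : Fin n → EuclideanSpace ℝ (Fin n) → ℝ}

lemma IsShellNormal.ae_ne (H : IsShellNormal d r g) {c : ℝ} (hc : |c| ≤ r) :
    ∀ᵐ x, d x ≠ c := by
  obtain ⟨Cd, hdL⟩ := H.lipschitz_dist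
  filter_upwards [hdL.ae_fderiv_eq_zero_of_eq c] with x hx hxc
  have h3 := H.sum_sq x (hxc ▸ hc)
  simp [← H.fderiv_eq _ x (hxc ▸ hc), hx hxc] at h3

/-- The interior version of the shell estimate, on the smaller shell `{|d| < s}`. -/
lemma IsShellNormal.abs_setIntegral_le (H : IsShellNormal d r g) {A : ℝ}
    (hA : ∀ x, |divergence g x| ≤ A) (hεr : ε ≤ r) (HW : IsProfile W ε)
    {h : EuclideanSpace ℝ (Fin n) → ℝ} (hd : ∀ x, |d x| < ε → DifferentiableAt ℝ h x)
    (hi : IntegrableOn (fun x => h x * W (d x)) {x | |d x| < ε})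
    (hdi : IntegrableOn (fun x => W (d x) • fderiv ℝ h x) {x | |d x| < ε})
    (hs : 0 < s) (hsε : s < ε) :
    |∫ x in {x | |d x| < s}, h x * profileDefect W (d x)| ≤
      ε * A * (∫ x in {x | |d x| < ε}, |h x * W (d x)|) +
        ε * n * ∫ x in {x | |d x| < ε}, ‖W (d x) • fderiv ℝ h x‖ := by
  obtain ⟨Cd, hdL⟩ := H.lipschitz_dist
  have hdc := hdL.continuous
  have hWc := HW.continuous
  have hVo : IsOpen {x | |d x| < ε} := isOpen_lt (by fun_prop) continuous_const
  have hNo : IsOpen {x | |d x| < s} := isOpen_lt (by fun_prop) continuous_const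
  have hKc : IsCompact {x | |d x| ≤ s} :=
    H.isCompact_shell.of_isClosed_subset (isClosed_le (by fun_prop) continuous_const)
      fun x (hx : |d x| ≤ s) => show |d x| ≤ r by linarith
  have hKV : {x | |d x| ≤ s} ⊆ {x | |d x| < ε} := fun x (hx : |d x| ≤ s) => hx.trans_lt hsε
  have hNK : {x | |d x| < s} ⊆ {x | |d x| ≤ s} := fun x (hx : |d x| < s) => hx.le
  set V := {x | |d x| < ε} with hVdef
  set K := {x | |d x| ≤ s} with hKdef
  set N := {x | |d x| < s} with hNdef
  have hWpos : ∀ x ∈ V, 0 < W (d x) := fun x hx => HW.pos _ ((le_abs_self _).trans_lt hx)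
  have hWinv : ContinuousOn (fun x => (W (d x))⁻¹) V :=
    (hWc.comp hdc).continuousOn.inv₀ fun x hx => (hWpos x hx).ne'
  have hloc : LocallyIntegrableOn h V := by
    rw [locallyIntegrableOn_iff hVo.isLocallyClosed]
    intro k hkV hk
    have h1 := (hi.mono_set hkV).mul_continuousOn (hWinv.mono hkV) hk
    refine h1.congr_fun (fun x hx => ?_) hk.measurableSet
    have := (hWpos x (hkV hx)).ne'
    simp only
    field_simp
  have hdloc : LocallyIntegrableOn (fderiv ℝ h) V := by
    rw [locallyIntegrableOn_iff hVo.isLocallyClosed]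
    intro k hkV hk
    have h1 := (hdi.mono_set hkV).continuousOn_smul (hWinv.mono hkV) hk
    refine h1.congr_fun (fun x hx => ?_) hk.measurableSet
    simp only [smul_smul]
    rw [inv_mul_cancel₀ (hWpos x (hkV hx)).ne', one_smul]
  obtain ⟨Z, hZ, hZd⟩ := HW.exists_countable_differentiableAt s
  have key := H.integral_mul_div (HW.lipschitzWith_profilePrimitive s) (hsε.le.trans hεr)
    (fun t ht => profilePrimitive_eq_zero ht) hZ hZd hVo hKV hd hloc hdloc
  have hhK : IntegrableOn h K := hloc.integrableOn_compact_subset hKV hKc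
  have hψ x : |profilePrimitive W s (d x)| ≤ ε * W (d x) :=
    (HW.abs_profilePrimitive_le hs.le _).trans
      (mul_le_mul_of_nonneg_right hsε.le (HW.nonneg _))
  have hψ0 : ∀ x ∉ V, profilePrimitive W s (d x) = 0 := fun x hx =>
    profilePrimitive_eq_zero (hsε.le.trans (not_lt.1 hx))
  have hA0 : 0 ≤ A := (abs_nonneg _).trans (hA 0)
  have hF_int : Integrable fun x => h x * (profilePrimitive W s (d x) * divergence g x) := by
    refine integrable_mul_of_bounded_of_support (M := ε * A) hhK
      (((HW.lipschitzWith_profilePrimitive s).continuous.comp hdc).measurable.mul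
        (measurable_divergence H.lipschitz)) (fun x => ?_) (fun x hx => ?_)
    · rw [abs_mul]
      have h1 : |profilePrimitive W s (d x)| ≤ ε := (hψ x).trans
        (mul_le_of_le_one_right (hs.trans hsε).le (HW.le_one _))
      exact mul_le_mul h1 (hA x) (abs_nonneg _) (hs.trans hsε).le
    · rw [profilePrimitive_eq_zero (not_le.1 hx).le, zero_mul]
  have hG_int : Integrable (N.indicator fun x => h x * profileDefect W (d x)) := by
    have h1 : IntegrableOn (fun x => h x * profileDefect W (d x)) N :=
      Integrable.mul_bdd (c := 1) (hhK.mono_set hNK)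
        (HW.measurable_profileDefect.comp hdc.measurable).aestronglyMeasurable
        (.of_forall fun x => (HW.abs_profileDefect_le _).trans (HW.le_one _))
    exact (integrable_indicator_iff hNo.measurableSet).2 h1
  have hae : ∀ᵐ x, h x * (deriv (profilePrimitive W s) (d x) +
      profilePrimitive W s (d x) * divergence g x) =
      h x * (profilePrimitive W s (d x) * divergence g x) -
        N.indicator (fun x => h x * profileDefect W (d x)) x := by
    have hsr : |s| ≤ r := by rw [abs_of_pos hs]; linarith
    filter_upwards [H.ae_ne (c := 0) (by rw [abs_zero]; linarith), H.ae_ne hsr,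
      H.ae_ne (c := -s) (by rwa [abs_neg])] with x h0 h1 h2
    by_cases hx : |d x| < s
    · rw [indicator_of_mem (show x ∈ N from hx), (HW.hasDerivAt_profilePrimitive h0 hx).deriv]
      ring
    · have hx' : s < |d x| := by
        refine lt_of_le_of_ne (not_lt.1 hx) fun heq => ?_
        rcases abs_choice (d x) with h' | h'
        · exact h1 (by linarith)
        · exact h2 (by linarith)
      rw [indicator_of_notMem (show x ∉ N from hx),
        (hasDerivAt_profilePrimitive_of_lt hx').deriv]
      ring
  rw [integral_congr_ae hae, integral_sub hF_int hG_int,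
    integral_indicator hNo.measurableSet] at key
  have heq : ∫ x in N, h x * profileDefect W (d x) =
      (∫ x, h x * (profilePrimitive W s (d x) * divergence g x)) +
        ∫ x, profilePrimitive W s (d x) *
          ∑ i, g i x * fderiv ℝ h x (EuclideanSpace.single i 1) := by linarith
  rw [heq]
  refine (abs_add_le _ _).trans (add_le_add ?_ ?_)
  · rw [← integral_const_mul, ← integral_indicator hVo.measurableSet, ← Real.norm_eq_abs]
    refine norm_integral_le_of_norm_le
      ((integrable_indicator_iff hVo.measurableSet).2 (hi.abs.const_mul _))
      (.of_forall fun x => ?_)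
    by_cases hx : x ∈ V
    · rw [indicator_of_mem hx, Real.norm_eq_abs, abs_mul, abs_mul, abs_mul,
        abs_of_nonneg (HW.nonneg (d x))]
      calc |h x| * (|profilePrimitive W s (d x)| * |divergence g x|)
          ≤ |h x| * ((ε * W (d x)) * A) := by
            gcongr
            · exact mul_nonneg (hs.trans hsε).le (HW.nonneg _)
            · exact hψ x
            · exact hA x
        _ = _ := by ring
    · simp [indicator_of_notMem hx, hψ0 x hx]
  · rw [← integral_const_mul, ← integral_indicator hVo.measurableSet, ← Real.norm_eq_abs]
    refine norm_integral_le_of_norm_le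
      ((integrable_indicator_iff hVo.measurableSet).2 (hdi.norm.const_mul _))
      (.of_forall fun x => ?_)
    by_cases hx : x ∈ V
    · rw [indicator_of_mem hx, Real.norm_eq_abs, abs_mul, norm_smul, Real.norm_eq_abs,
        abs_of_nonneg (HW.nonneg (d x))]
      have hsum : |∑ i, g i x * fderiv ℝ h x (EuclideanSpace.single i 1)| ≤
          n * ‖fderiv ℝ h x‖ := by
        refine (Finset.abs_sum_le_sum_abs _ _).trans ?_
        refine (Finset.sum_le_card_nsmul _ _ ‖fderiv ℝ h x‖ fun i _ => ?_).trans_eq (by simp)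
        rw [abs_mul]
        have h1 := (fderiv ℝ h x).le_opNorm (EuclideanSpace.single i (1 : ℝ))
        rw [PiLp.norm_single, norm_one, mul_one, Real.norm_eq_abs] at h1
        exact (mul_le_of_le_one_left (abs_nonneg _) (H.abs_component_le i x)).trans h1
      calc _ ≤ (ε * W (d x)) * (n * ‖fderiv ℝ h x‖) := by
            gcongr
            · exact mul_nonneg (hs.trans hsε).le (HW.nonneg _)
            · exact hψ x
        _ = _ := by ring
    · simp [indicator_of_notMem hx, hψ0 x hx]

lemma IsProfile.integrableOn_mul_profileDefect {μ : Measure (EuclideanSpace ℝ (Fin n))}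
    (HW : IsProfile W ε) (hdm : Measurable d) {h : EuclideanSpace ℝ (Fin n) → ℝ}
    (hh : Measurable h) (hi : Integrable (fun x => h x * W (d x)) μ) :
    Integrable (fun x => h x * profileDefect W (d x)) μ := by
  refine hi.mono (hh.mul (HW.measurable_profileDefect.comp hdm)).aestronglyMeasurable
    (.of_forall fun x => ?_)
  rw [norm_mul, norm_mul]
  gcongr
  rw [Real.norm_eq_abs, Real.norm_eq_abs, abs_of_nonneg (HW.nonneg _)]
  exact HW.abs_profileDefect_le _

/-- The shell estimate: the oddness of the defect gains a factor `ε`. -/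
lemma IsShellNormal.abs_setIntegral_profileDefect_le (H : IsShellNormal d r g) {A : ℝ}
    (hA : ∀ x, |divergence g x| ≤ A) (hε : 0 < ε) (hεr : ε ≤ r) (HW : IsProfile W ε)
    {h : EuclideanSpace ℝ (Fin n) → ℝ} (hh : Measurable h)
    (hd : ∀ x, |d x| < ε → DifferentiableAt ℝ h x)
    (hi : IntegrableOn (fun x => h x * W (d x)) {x | |d x| < ε})
    (hdi : IntegrableOn (fun x => W (d x) • fderiv ℝ h x) {x | |d x| < ε}) :
    |∫ x in {x | |d x| < ε}, h x * profileDefect W (d x)| ≤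
      ε * A * (∫ x in {x | |d x| < ε}, |h x * W (d x)|) +
        ε * n * ∫ x in {x | |d x| < ε}, ‖W (d x) • fderiv ℝ h x‖ := by
  obtain ⟨Cd, hdL⟩ := H.lipschitz_dist
  have hdc := hdL.continuous
  obtain ⟨u, hu_mono, hu_mem, hu_lim⟩ := exists_seq_strictMono_tendsto' hε
  have hUnion : ⋃ k, {x | |d x| < u k} = {x | |d x| < ε} := by
    ext x
    simp only [mem_iUnion, mem_ofPred_eq]
    refine ⟨fun ⟨k, hk⟩ => hk.trans (hu_mem k).2, fun hx => ?_⟩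
    exact (hu_lim.eventually (lt_mem_nhds hx)).exists
  have hlim := tendsto_setIntegral_of_monotone (μ := volume)
    (s := fun k => {x | |d x| < u k}) (f := fun x => h x * profileDefect W (d x))
    (fun k => (isOpen_lt (by fun_prop) continuous_const).measurableSet)
    (fun a b hab x (hx : |d x| < u a) => hx.trans_le (hu_mono.monotone hab))
    (by rw [hUnion]; exact HW.integrableOn_mul_profileDefect hdc.measurable hh hi)
  rw [hUnion] at hlim
  exact le_of_tendsto hlim.abs (.of_forall fun k =>
    H.abs_setIntegral_le hA hεr HW hd hi hdi (hu_mem k).1 (hu_mem k).2)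

end Profile

section OrientedDistance

variable {n : ℕ} {D : Set (EuclideanSpace ℝ (Fin n))} {d : EuclideanSpace ℝ (Fin n) → ℝ}

lemma lipschitzWith_orientedDist
    (hd : ∀ x, d x = Metric.infDist x D - Metric.infDist x Dᶜ) : LipschitzWith 2 d := by
  have h := (Metric.lipschitz_infDist_pt D).sub (Metric.lipschitz_infDist_pt Dᶜ)
  rw [one_add_one_eq_two] at h
  exact (funext hd : d = _) ▸ h

lemma orientedDist_of_notMem (hd : ∀ x, d x = Metric.infDist x D - Metric.infDist x Dᶜ)
    {x : EuclideanSpace ℝ (Fin n)} (hx : x ∉ D) : d x = Metric.infDist x D := by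
  rw [hd, Metric.infDist_zero_of_mem (show x ∈ Dᶜ from hx), sub_zero]

lemma orientedDist_of_mem (hd : ∀ x, d x = Metric.infDist x D - Metric.infDist x Dᶜ)
    {x : EuclideanSpace ℝ (Fin n)} (hx : x ∈ D) : d x = -Metric.infDist x Dᶜ := by
  rw [hd, Metric.infDist_zero_of_mem hx, zero_sub]

lemma mem_iff_orientedDist_neg (hDo : IsOpen D) (hDc : Dᶜ.Nonempty)
    (hd : ∀ x, d x = Metric.infDist x D - Metric.infDist x Dᶜ) (x : EuclideanSpace ℝ (Fin n)) :
    x ∈ D ↔ d x < 0 := by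
  refine ⟨fun hx => ?_, fun hx => ?_⟩
  · rw [orientedDist_of_mem hd hx, neg_lt_zero]
    exact (hDo.isClosed_compl.notMem_iff_infDist_pos hDc).1 (not_not.2 hx)
  · by_contra h
    rw [orientedDist_of_notMem hd h] at hx
    exact hx.not_ge Metric.infDist_nonneg

lemma mem_frontier_of_orientedDist_eq_zero (hDo : IsOpen D) (hDne : D.Nonempty)
    (hDc : Dᶜ.Nonempty) (hd : ∀ x, d x = Metric.infDist x D - Metric.infDist x Dᶜ)
    {x : EuclideanSpace ℝ (Fin n)} (hx : d x = 0) : x ∈ frontier D := by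
  have hxD : x ∉ D := fun h => ((mem_iff_orientedDist_neg hDo hDc hd x).1 h).ne hx
  rw [hDo.frontier_eq]
  refine ⟨?_, hxD⟩
  rw [Metric.mem_closure_iff_infDist_zero hDne, ← orientedDist_of_notMem hd hxD, hx]

lemma isCompact_orientedDist_le (hDb : Bornology.IsBounded D) (hDne : D.Nonempty)
    (hd : ∀ x, d x = Metric.infDist x D - Metric.infDist x Dᶜ) {ρ : ℝ} (hρ : 0 ≤ ρ) :
    IsCompact (closure {x | d x ≤ ρ}) := by
  refine Bornology.IsBounded.isCompact_closure (hDb.cthickening.subset (t := Metric.cthickening ρ D)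
    fun x (hx : d x ≤ ρ) => ?_)
  rw [Metric.mem_cthickening_iff,
    ENNReal.le_ofReal_iff_toReal_le (Metric.infEDist_ne_top hDne) hρ]
  change Metric.infDist x D ≤ ρ
  by_cases h : x ∈ D
  · rwa [Metric.infDist_zero_of_mem h]
  · rwa [← orientedDist_of_notMem hd h]

lemma volume_orientedDist_lt_lt_top (hDb : Bornology.IsBounded D) (hDne : D.Nonempty)
    (hd : ∀ x, d x = Metric.infDist x D - Metric.infDist x Dᶜ) {ρ : ℝ} (hρ : 0 ≤ ρ) :
    volume {x | d x < ρ} < ⊤ :=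
  (measure_mono fun x (hx : d x < ρ) => subset_closure (show d x ≤ ρ from hx.le)).trans_lt
    (isCompact_orientedDist_le hDb hDne hd hρ).measure_lt_top

lemma isCompact_abs_orientedDist_le (hDb : Bornology.IsBounded D) (hDne : D.Nonempty)
    (hd : ∀ x, d x = Metric.infDist x D - Metric.infDist x Dᶜ) {ρ : ℝ} (hρ : 0 ≤ ρ) :
    IsCompact {x | |d x| ≤ ρ} := by
  have hdc := (lipschitzWith_orientedDist hd).continuous
  exact (isCompact_orientedDist_le hDb hDne hd hρ).of_isClosed_subset
    (isClosed_le (by fun_prop) continuous_const)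
    fun x (hx : |d x| ≤ ρ) => subset_closure (show d x ≤ ρ from (le_abs_self _).trans hx)

lemma norm_fderiv_orientedDist_eq_one_of_ne (hDo : IsOpen D) (hDne : D.Nonempty)
    (hDc : Dᶜ.Nonempty) (hd : ∀ x, d x = Metric.infDist x D - Metric.infDist x Dᶜ)
    {x : EuclideanSpace ℝ (Fin n)} (hx : d x ≠ 0) (hdx : DifferentiableAt ℝ d x) :
    ‖fderiv ℝ d x‖ = 1 := by
  have hdc := (lipschitzWith_orientedDist hd).continuous
  rcases lt_or_gt_of_ne hx with h | h
  · have hev : d =ᶠ[𝓝 x] -fun y => Metric.infDist y Dᶜ := by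
      filter_upwards [hdc.continuousAt.eventually_lt_const h] with y hy
      exact orientedDist_of_mem hd ((mem_iff_orientedDist_neg hDo hDc hd y).2 hy)
    have hdiff : DifferentiableAt ℝ (fun y => Metric.infDist y Dᶜ) x := by
      rw [← differentiableAt_neg_iff]
      exact hev.differentiableAt_iff.1 hdx
    rw [hev.fderiv_eq, fderiv_neg, norm_neg]
    refine norm_fderiv_infDist_eq_one hDc ?_ hdiff
    rw [hDo.isClosed_compl.closure_eq]
    exact not_not.2 ((mem_iff_orientedDist_neg hDo hDc hd x).2 h)
  · have hev : d =ᶠ[𝓝 x] fun y => Metric.infDist y D := by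
      filter_upwards [hdc.continuousAt.eventually_const_lt h] with y hy
      exact orientedDist_of_notMem hd
        fun h' => ((mem_iff_orientedDist_neg hDo hDc hd y).1 h').not_gt hy
    rw [hev.fderiv_eq]
    refine norm_fderiv_infDist_eq_one hDne ?_ (hev.differentiableAt_iff.1 hdx)
    rw [Metric.mem_closure_iff_infDist_zero hDne, ← orientedDist_of_notMem hd
      fun h' => ((mem_iff_orientedDist_neg hDo hDc hd x).1 h').not_gt h]
    exact hx

/-- A domain with `C^{1,1}` boundary carries a shell normal. -/
lemma exists_isShellNormal_orientedDist (hDo : IsOpen D) (hDb : Bornology.IsBounded D)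
    (hDne : D.Nonempty) (hDc : Dᶜ.Nonempty)
    (hd : ∀ x, d x = Metric.infDist x D - Metric.infDist x Dᶜ)
    {U : Set (EuclideanSpace ℝ (Fin n))} (hU : IsOpen U) (hDU : frontier D ⊆ U)
    (hdU : ContDiffOn ℝ 1 d U) {L : NNReal} (hL : LipschitzOnWith L (fun x => fderiv ℝ d x) U) :
    ∃ r, 0 < r ∧ ∃ g, IsShellNormal d r g := by
  have hdc := (lipschitzWith_orientedDist hd).continuous
  obtain ⟨r, hr, hrU⟩ : ∃ r, 0 < r ∧ ∀ x, |d x| ≤ r → x ∈ U := by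
    have hK : IsCompact ({x | |d x| ≤ 1} ∩ Uᶜ) :=
      (isCompact_abs_orientedDist_le hDb hDne hd zero_le_one).inter_right hU.isClosed_compl
    obtain ⟨c, hc, hcK⟩ := hK.exists_forall_le' (f := fun x => |d x|) (by fun_prop) (a := 0)
      fun x hx => abs_pos.2 fun h0 =>
        hx.2 (hDU (mem_frontier_of_orientedDist_eq_zero hDo hDne hDc hd h0))
    refine ⟨min (c / 2) 1, by positivity, fun x hx => by_contra fun hxU => ?_⟩
    have h1 := hcK x ⟨hx.trans (min_le_right _ _), hxU⟩
    have h2 := hx.trans (min_le_left _ _)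
    linarith
  have hdiff x (hx : x ∈ U) : DifferentiableAt ℝ d x :=
    (hdU.differentiableOn one_ne_zero).differentiableAt (hU.mem_nhds hx)
  have hnorm x (hx : |d x| ≤ r) : ‖fderiv ℝ d x‖ = 1 := by
    rcases ne_or_eq (d x) 0 with h | h
    · exact norm_fderiv_orientedDist_eq_one_of_ne hDo hDne hDc hd h (hdiff x (hrU x hx))
    · have hxcl : x ∈ closure D :=
        (mem_frontier_of_orientedDist_eq_zero hDo hDne hDc hd h).1
      have hcont : ContinuousAt (fun y => ‖fderiv ℝ d y‖) x :=
        (hL.continuousOn.continuousAt (hU.mem_nhds (hrU x hx))).norm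
      have hfreq : ∃ᶠ y in 𝓝 x, ‖fderiv ℝ d y‖ = 1 := by
        refine ((mem_closure_iff_frequently.1 hxcl).and_eventually
          (hU.mem_nhds (hrU x hx))).mono fun y hy => ?_
        exact norm_fderiv_orientedDist_eq_one_of_ne hDo hDne hDc hd
          ((mem_iff_orientedDist_neg hDo hDc hd y).1 hy.1).ne (hdiff y hy.2)
      by_contra hne
      exact hfreq (hcont.eventually_ne hne)
  have hcomp i x : |fderiv ℝ d x (EuclideanSpace.single i 1)| ≤ ‖fderiv ℝ d x‖ := by
    have h1 := (fderiv ℝ d x).le_opNorm (EuclideanSpace.single i (1 : ℝ))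
    rwa [PiLp.norm_single, norm_one, mul_one] at h1
  have hcompL i : LipschitzOnWith L
      (fun x => fderiv ℝ d x (EuclideanSpace.single i 1)) U := by
    refine LipschitzOnWith.of_dist_le_mul fun x hx y hy => ?_
    refine le_trans ?_ (hL.dist_le_mul x hx y hy)
    rw [dist_eq_norm, dist_eq_norm, ← sub_apply]
    have h1 := (fderiv ℝ d x - fderiv ℝ d y).le_opNorm (EuclideanSpace.single i (1 : ℝ))
    rwa [PiLp.norm_single, norm_one, mul_one] at h1
  choose G hGL hG using fun i => (hcompL i).extend_real
  have hfd i x (hx : |d x| ≤ r) :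
      fderiv ℝ d x (EuclideanSpace.single i 1) = max (min (G i x) 1) (-1) := by
    have h1 := abs_le.1 ((hcomp i x).trans_eq (hnorm x hx))
    rw [← hG i (hrU x hx), min_eq_left h1.2, max_eq_left h1.1]
  refine ⟨r, hr, fun i x => max (min (G i x) 1) (-1), ⟨2, lipschitzWith_orientedDist hd⟩,
    isCompact_abs_orientedDist_le hDb hDne hd hr.le,
    ⟨L, fun i => ((hGL i).min_const 1).max_const (-1)⟩, fun i x => ?_, hfd, fun x hx => ?_⟩
  · exact abs_le.2 ⟨le_max_right _ _, max_le (min_le_right _ _) (by norm_num)⟩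
  · have h1 := (EuclideanSpace.basisFun (Fin n) ℝ).norm_dual (fderiv ℝ d x)
    rw [hnorm x hx, one_pow] at h1
    refine Eq.trans (Finset.sum_congr rfl fun i _ => ?_) h1.symm
    rw [← hfd i x hx, EuclideanSpace.basisFun_apply]

end OrientedDistance

section PhaseField

/-- The profile `(1 + S(-t/ε))/2` built from an odd sigmoid `S` is a transition profile. -/
lemma isProfile_of_sigmoid {S : ℝ → ℝ} {ζ α ε : ℝ} (hζ : 0 < ζ) (hSc : Continuous S)
    (hS_sign : ∀ t : ℝ, 1 ≤ |t| → S t = t / |t|) (hS_pos : ∀ t : ℝ, |t| < 1 → 0 < deriv S t)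
    (hS_odd : ∀ t : ℝ, S (-t) = -S t)
    (hS_low : ∀ t ∈ Ioo (0 : ℝ) 2, ζ * t ^ α ≤ (1 + S (t - 1)) / 2) (hε : 0 < ε) :
    IsProfile (fun t => (1 + S (-t / ε)) / 2) ε := by
  have hge t (ht : 1 ≤ t) : S t = 1 := by
    rw [hS_sign t (ht.trans (le_abs_self t)), abs_of_pos (by linarith), div_self (by linarith)]
  have hle t (ht : t ≤ -1) : S t = -1 := by
    have := hS_odd t
    rw [hge (-t) (by linarith)] at this
    linarith
  have hmid : StrictMonoOn S (Icc (-1) 1) :=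
    strictMonoOn_of_deriv_pos (convex_Icc _ _) hSc.continuousOn fun t ht => by
      rw [interior_Icc] at ht
      exact hS_pos t (abs_lt.2 ht)
  have hmono : Monotone S := by
    refine MonotoneOn.Iic_union_Ici (a := -1) (fun x hx y hy _ => ?_) ?_
    · rw [hle x hx, hle y hy]
    · have h2 : MonotoneOn S (Ici 1) := fun x hx y hy _ => by rw [hge x hx, hge y hy]
      have h3 := hmid.monotoneOn.union_right h2 (isGreatest_Icc (by norm_num)) isLeast_Ici
      rwa [Icc_union_Ici_eq_Ici (by norm_num)] at h3
  have hbd t : -1 ≤ S t := by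
    rcases le_total t (-1) with h | h
    · rw [hle t h]
    · rw [← hle (-1) le_rfl]
      exact hmono h
  refine ⟨by fun_prop, fun x y hxy => ?_, fun t => ?_, fun t => ?_, fun t ht => ?_⟩
  · have h1 : -y / ε ≤ -x / ε := by gcongr
    have h2 := hmono h1
    linarith
  · rw [neg_div, hS_odd]
    ring
  · have := hbd (-t / ε)
    linarith
  · have h1 : 0 < 1 + -t / ε := by
      have := (div_lt_one hε).2 ht
      rw [neg_div]
      linarith
    rcases lt_or_ge (1 + -t / ε) 2 with h2 | h2
    · have h3 := hS_low _ ⟨h1, h2⟩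
      rw [add_sub_cancel_left] at h3
      exact (mul_pos hζ (Real.rpow_pos_of_pos h1 α)).trans_le h3
    · rw [hge _ (by linarith)]
      norm_num

variable {n : ℕ} {W : ℝ → ℝ} {ε r : ℝ} {d : EuclideanSpace ℝ (Fin n) → ℝ}

lemma IsProfile.eq_zero_of_le (H : IsProfile W ε) (h1 : W (-ε) = 1) {t : ℝ} (ht : ε ≤ t) :
    W t = 0 := by
  have h2 := H.antitone ht
  have h3 := H.nonneg t
  have h4 := H.map_neg ε
  linarith

lemma IsProfile.profileDefect_eq_zero_of_le_neg (H : IsProfile W ε) (h1 : W (-ε) = 1)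
    (hε : 0 < ε) {t : ℝ} (ht : t ≤ -ε) : profileDefect W t = 0 := by
  have h2 := H.antitone ht
  have h3 := H.le_one t
  rw [profileDefect, indicator_of_mem (show t ∈ Iio 0 from ht.trans_lt (by linarith)),
    Pi.one_apply]
  linarith

/-- The diffuse volume error is an integral of the profile defect over the transition layer. -/
lemma IsProfile.volumeError_eq (H : IsProfile W ε) (h1 : W (-ε) = 1) (hε : 0 < ε)
    (hdm : Measurable d) {Ω : Set (EuclideanSpace ℝ (Fin n))} (hΩm : MeasurableSet Ω)
    (hΩ : {x | d x < ε} ⊆ Ω) {h : EuclideanSpace ℝ (Fin n) → ℝ} (hh : Measurable h)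
    (hi : IntegrableOn (fun x => h x * W (d x)) {x | d x < ε}) :
    (∫ x in Ω, h x * W (d x)) - ∫ x in {x | d x < 0}, h x =
      ∫ x in {x | |d x| < ε}, h x * profileDefect W (d x) := by
  have hi' := H.integrableOn_mul_profileDefect hdm hh hi
  have hm (c : ℝ) : MeasurableSet {x | d x < c} := measurableSet_lt hdm measurable_const
  have hΩ_eq : ∫ x in Ω, h x * W (d x) = ∫ x in {x | d x < ε}, h x * W (d x) :=
    setIntegral_eq_of_subset_of_forall_sdiff_eq_zero hΩm hΩ fun x hx => by
      rw [H.eq_zero_of_le h1 (not_lt.1 hx.2), mul_zero]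
  have hD_eq : ∫ x in {x | d x < 0}, h x =
      ∫ x in {x | d x < ε}, h x * (Iio (0 : ℝ)).indicator 1 (d x) := by
    have h2 : ∫ x in {x | d x < 0}, h x =
        ∫ x in {x | d x < 0}, h x * (Iio (0 : ℝ)).indicator 1 (d x) :=
      setIntegral_congr_fun (hm 0) fun x hx => by
        rw [indicator_of_mem (show d x ∈ Iio 0 from hx), Pi.one_apply, mul_one]
    rw [h2]
    refine (setIntegral_eq_of_subset_of_forall_sdiff_eq_zero (hm ε)
      (fun x (hx : d x < 0) => hx.trans hε) fun x hx => ?_).symm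
    rw [indicator_of_notMem (show d x ∉ Iio 0 from hx.2), mul_zero]
  have hN_eq : ∫ x in {x | |d x| < ε}, h x * profileDefect W (d x) =
      ∫ x in {x | d x < ε}, h x * profileDefect W (d x) := by
    refine (setIntegral_eq_of_subset_of_forall_sdiff_eq_zero (hm ε)
      (fun x (hx : |d x| < ε) => (le_abs_self _).trans_lt hx) fun x hx => ?_).symm
    have h3 : d x ≤ -ε := by
      by_contra h4
      exact hx.2 (abs_lt.2 ⟨not_le.1 h4, hx.1⟩)
    rw [H.profileDefect_eq_zero_of_le_neg h1 hε h3, mul_zero]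
  rw [hΩ_eq, hD_eq, hN_eq, sub_eq_iff_eq_add, ← sub_eq_iff_eq_add', ← integral_sub hi hi']
  refine integral_congr_ae (.of_forall fun x => ?_)
  simp only [profileDefect]
  ring

variable {g : Fin n → EuclideanSpace ℝ (Fin n) → ℝ}

/-- The shell estimate with a constant that is uniform in the width of the layer. -/
lemma IsShellNormal.exists_abs_setIntegral_profileDefect_le (H : IsShellNormal d r g)
    (hr : 0 < r) : ∃ C, 0 < C ∧ ∀ ε, 0 < ε → ∀ W, IsProfile W ε →
      ∀ h : EuclideanSpace ℝ (Fin n) → ℝ, Measurable h →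
      (∀ x, |d x| < ε → DifferentiableAt ℝ h x) →
      IntegrableOn (fun x => h x * W (d x)) {x | |d x| < ε} →
      IntegrableOn (fun x => W (d x) • fderiv ℝ h x) {x | |d x| < ε} →
      |∫ x in {x | |d x| < ε}, h x * profileDefect W (d x)| ≤
        C * ε * ((∫ x in {x | |d x| < ε}, |h x * W (d x)|) +
          ∫ x in {x | |d x| < ε}, ‖W (d x) • fderiv ℝ h x‖) := by
  obtain ⟨A, hA0, hA⟩ := exists_abs_divergence_le H.lipschitz
  refine ⟨A + n + 1 / r, by positivity, fun ε hε W HW h hh hd hi hdi => ?_⟩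
  have hI : 0 ≤ ∫ x in {x | |d x| < ε}, |h x * W (d x)| :=
    integral_nonneg fun x => abs_nonneg _
  have hJ : 0 ≤ ∫ x in {x | |d x| < ε}, ‖W (d x) • fderiv ℝ h x‖ :=
    integral_nonneg fun x => norm_nonneg _
  set I := ∫ x in {x | |d x| < ε}, |h x * W (d x)|
  set J := ∫ x in {x | |d x| < ε}, ‖W (d x) • fderiv ℝ h x‖
  rcases le_or_gt ε r with hεr | hεr
  · refine (H.abs_setIntegral_profileDefect_le hA hε hεr HW hh hd hi hdi).trans ?_
    have h1 : 0 ≤ ε * ((n + 1 / r) * I + (A + 1 / r) * J) := by positivity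
    calc ε * A * I + ε * n * J
        ≤ ε * A * I + ε * n * J + ε * ((n + 1 / r) * I + (A + 1 / r) * J) := by linarith
      _ = _ := by ring
  · obtain ⟨Cd, hdL⟩ := H.lipschitz_dist
    have h1 : |∫ x in {x | |d x| < ε}, h x * profileDefect W (d x)| ≤ I := by
      rw [← Real.norm_eq_abs]
      refine norm_integral_le_of_norm_le hi.abs (.of_forall fun x => ?_)
      rw [norm_mul, abs_mul, Real.norm_eq_abs, Real.norm_eq_abs, abs_of_nonneg (HW.nonneg (d x))]
      gcongr
      exact HW.abs_profileDefect_le _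
    refine h1.trans ?_
    have h2 : 1 ≤ (A + n + 1 / r) * ε := by
      have h3 : 1 ≤ ε / r := (one_le_div hr).2 hεr.le
      have h4 : 0 ≤ (A + n) * ε := by positivity
      calc (1 : ℝ) ≤ (A + n) * ε + ε / r := by linarith
        _ = _ := by ring
    calc I ≤ I + J := by linarith
      _ ≤ _ := le_mul_of_one_le_left (by positivity) h2

/-- The volume of the layer is linear in its width. -/
lemma IsShellNormal.exists_volume_layer_le (H : IsShellNormal d r g) (hr : 0 < r) {ε₀ : ℝ}
    (hfin : volume {x | d x < ε₀} < ⊤) : ∃ C, 0 < C ∧ ∀ ε ∈ Ioc 0 ε₀,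
      volume {x | |d x| < ε} ≤ ENNReal.ofReal (C * ε) := by
  obtain ⟨C, hC, hCε⟩ := H.exists_volume_le hr
  set V := volume.real {x | d x < ε₀}
  have hV : 0 ≤ V := measureReal_nonneg
  refine ⟨C + V * (2 / r) + 1, by positivity, fun ε hε => ?_⟩
  have hε0 := hε.1
  have hsub : {x | |d x| < ε} ⊆ {x | d x < ε₀} := fun x (hx : |d x| < ε) =>
    ((le_abs_self _).trans_lt hx).trans_le hε.2
  have hfin' : volume {x | |d x| < ε} ≠ ⊤ := ((measure_mono hsub).trans_lt hfin).ne
  rw [← ofReal_measureReal hfin']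
  refine ENNReal.ofReal_le_ofReal ?_
  have h0 : 0 ≤ V * (2 / r) * ε := by positivity
  rcases le_or_gt ε (r / 2) with h | h
  · refine (hCε ε hε0 h).trans ?_
    linarith
  · have h1 : volume.real {x | |d x| < ε} ≤ V := measureReal_mono hsub hfin.ne
    have h2 : 1 ≤ 2 / r * ε := by
      have := (one_le_div (by positivity)).2 h.le
      calc (1 : ℝ) ≤ ε / (r / 2) := this
        _ = _ := by field_simp
    have h3 : V ≤ V * (2 / r * ε) := le_mul_of_one_le_right hV h2
    have h4 : 0 ≤ C * ε := by positivity
    linarith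

end PhaseField

section WeightedMeasure

variable {n : ℕ} {A B : Set (EuclideanSpace ℝ (Fin n))} {w : EuclideanSpace ℝ (Fin n) → ℝ}
  {F : Type*} [NormedAddCommGroup F]

lemma wMeas_mono (hAB : A ⊆ B) : wMeas A w ≤ wMeas B w := by
  refine Measure.le_iff.2 fun s hs => ?_
  rw [wMeas, wMeas, withDensity_apply _ hs, withDensity_apply _ hs]
  exact lintegral_mono' (Measure.restrict_mono_measure (Measure.restrict_mono hAB le_rfl) s) le_rfl

lemma wMeas_univ_le (hw : ∀ x, w x ≤ 1) : wMeas A w univ ≤ volume A := by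
  rw [wMeas, withDensity_apply _ MeasurableSet.univ, Measure.restrict_univ]
  refine (lintegral_mono (g := fun _ => 1) fun x => ?_).trans (by simp)
  simpa using hw x

lemma integrable_wMeas_iff [NormedSpace ℝ F] (hwm : Measurable w) (hw : ∀ x, 0 ≤ w x)
    {f : EuclideanSpace ℝ (Fin n) → F} :
    Integrable f (wMeas A w) ↔ IntegrableOn (fun x => w x • f x) A := by
  rw [wMeas, integrable_withDensity_iff_integrable_smul' hwm.ennreal_ofReal (by simp)]
  simp only [ENNReal.toReal_ofReal (hw _)]
  rfl

lemma eLpNorm_one_wMeas [NormedSpace ℝ F] (hwm : Measurable w) (hw : ∀ x, 0 ≤ w x)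
    {f : EuclideanSpace ℝ (Fin n) → F} (hf : Integrable f (wMeas A w)) :
    eLpNorm f 1 (wMeas A w) = ENNReal.ofReal (∫ x in A, ‖w x • f x‖) := by
  rw [eLpNorm_one_eq_lintegral_enorm, ← ofReal_integral_norm_eq_lintegral_enorm hf, wMeas,
    integral_withDensity_eq_integral_toReal_smul hwm.ennreal_ofReal (by simp)]
  simp only [ENNReal.toReal_ofReal (hw _), norm_smul, Real.norm_eq_abs, abs_of_nonneg (hw _),
    smul_eq_mul]

/-- Hölder's inequality against a constant, for a measure of small total mass. -/
lemma eLpNorm_one_le_ofReal_mul_eLpNorm {X : Type*} [MeasurableSpace X] {μ ν : Measure X}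
    (hμν : μ ≤ ν) {p : ℝ≥0∞} (hp : 1 ≤ p) {δ : ℝ} (hδ : 0 ≤ δ)
    (hμ : μ univ ≤ ENNReal.ofReal δ) {f : X → F} (hf : AEStronglyMeasurable f μ) :
    eLpNorm f 1 μ ≤ ENNReal.ofReal (δ ^ (1 - (1 / p).toReal)) * eLpNorm f p ν := by
  have hp' : (1 / p).toReal ≤ 1 := by
    refine ENNReal.toReal_le_of_le_ofReal zero_le_one ?_
    rw [ENNReal.ofReal_one, one_div]
    exact ENNReal.inv_le_one.2 hp
  have h1 := eLpNorm_le_eLpNorm_mul_rpow_measure_univ hp hf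
  have hexp : 1 / (1 : ℝ≥0∞).toReal - 1 / p.toReal = 1 - (1 / p).toReal := by
    simp [ENNReal.toReal_inv]
  rw [hexp] at h1
  refine h1.trans ?_
  rw [mul_comm, ← ENNReal.ofReal_rpow_of_nonneg hδ (by linarith)]
  gcongr

end WeightedMeasure

/-- Convergence of diffuse volume integrals with rate `ε^{2-1/p}` for
`W^{1,p}(D_ε;ω^ε)` integrands. -/
theorem diffuse_volume_integral_W1p
    (n : ℕ) (hn : 2 ≤ n)
    (D : Set (EuclideanSpace ℝ (Fin n)))
    (hD_open : IsOpen D) (hD_bdd : Bornology.IsBounded D) (hD_ne : D.Nonempty)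
    (dD : EuclideanSpace ℝ (Fin n) → ℝ)
    (hdD : ∀ x, dD x = Metric.infDist x D - Metric.infDist x Dᶜ)
    (Dt : ℝ → Set (EuclideanSpace ℝ (Fin n)))
    (hDt : ∀ t, Dt t = {x | dD x < t})
    (Γ : ℝ → Set (EuclideanSpace ℝ (Fin n)))
    (hΓ : ∀ ε : ℝ, Γ ε = Dt ε \ closure (Dt (-ε)))
    (ε₀ : ℝ) (hε₀ : 0 < ε₀)
    (hproj : ∀ z ∈ Γ (2 * ε₀), ∃! y, y ∈ frontier D ∧ dist z y = Metric.infDist z (frontier D))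
    (hC11 : ∃ U : Set (EuclideanSpace ℝ (Fin n)), IsOpen U ∧ frontier D ⊆ U ∧
      ContDiffOn ℝ 1 dD U ∧ ∃ L : NNReal, LipschitzOnWith L (fun x => fderiv ℝ dD x) U)
    (S : ℝ → ℝ) (ζ₁ ζ₂ α : ℝ) (hζ₁ : 0 < ζ₁) (hζ₂ : 0 < ζ₂) (hα : 0 < α)
    (hS_lip : ∃ L : NNReal, LipschitzWith L S)
    (hS_sign : ∀ t : ℝ, 1 ≤ |t| → S t = t / |t|)
    (hS_pos : ∀ t : ℝ, |t| < 1 → 0 < deriv S t)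
    (hS_odd : ∀ t : ℝ, S (-t) = -S t)
    (hS2 : ∀ t ∈ Set.Ioo (0:ℝ) 2,
      ζ₁ * t ^ α ≤ (1 + S (t - 1)) / 2 ∧ (1 + S (t - 1)) / 2 ≤ ζ₂ * t ^ α)
    (ω : ℝ → EuclideanSpace ℝ (Fin n) → ℝ)
    (hω : ∀ ε : ℝ, 0 < ε → ∀ x, ω ε x = (1 + S (-(dD x) / ε)) / 2)
    (Ω : Set (EuclideanSpace ℝ (Fin n))) (hΩ_open : IsOpen Ω) (hΩ_bdd : Bornology.IsBounded Ω)
    (hΩD : closure (Dt ε₀) ⊆ Ω)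
 :
    ∀ p : ℝ≥0∞, 1 ≤ p →
      ∃ C : ℝ, 0 < C ∧ ∀ ε ∈ Set.Ioc (0:ℝ) ε₀,
        ∀ h : EuclideanSpace ℝ (Fin n) → ℝ, Measurable h →
          (∀ x ∈ Dt ε, DifferentiableAt ℝ h x) →
          eLpNorm h p (wMeas (Dt ε) (ω ε)) +
            eLpNorm (fun x => ‖fderiv ℝ h x‖) p (wMeas (Dt ε) (ω ε)) < ⊤ →
          ENNReal.ofReal |(∫ x in Ω, h x * ω ε x) - ∫ x in D, h x| ≤
            ENNReal.ofReal (C * ε ^ (2 - (1 / p).toReal)) *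
              (eLpNorm h p (wMeas (Γ ε) (ω ε)) +
                eLpNorm (fun x => ‖fderiv ℝ h x‖) p (wMeas (Γ ε) (ω ε))) := by
  intro p hp
  have hDc : Dᶜ.Nonempty := by
    have : NeZero n := ⟨by omega⟩
    rw [nonempty_compl]
    rintro rfl
    exact NormedSpace.unbounded_univ ℝ (EuclideanSpace ℝ (Fin n)) hD_bdd
  obtain ⟨U, hU, hDU, hdU, L, hL⟩ := hC11
  obtain ⟨r, hr, g, H⟩ :=
    exists_isShellNormal_orientedDist hD_open hD_bdd hD_ne hDc hdD hU hDU hdU hL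
  have hdc : Continuous dD := (lipschitzWith_orientedDist hdD).continuous
  obtain ⟨C₁, hC₁, hest⟩ := H.exists_abs_setIntegral_profileDefect_le hr
  have hfin : volume {x | dD x < ε₀} < ⊤ :=
    volume_orientedDist_lt_lt_top hD_bdd hD_ne hdD hε₀.le
  obtain ⟨C₂, hC₂, hvol⟩ := H.exists_volume_layer_le hr hfin
  refine ⟨C₁ * C₂ ^ (1 - (1 / p).toReal), by positivity, fun ε hε h hh hhd hnorm => ?_⟩
  have hε0 : 0 < ε := hε.1
  obtain ⟨LS, hLS⟩ := hS_lip
  obtain ⟨W, HW, hW1, hωW⟩ : ∃ W, IsProfile W ε ∧ W (-ε) = 1 ∧ ω ε = fun x => W (dD x) := by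
    refine ⟨_, isProfile_of_sigmoid hζ₁ hLS.continuous hS_sign hS_pos hS_odd
      (fun t ht => (hS2 t ht).1) hε0, ?_, funext (hω ε hε0)⟩
    rw [neg_neg, div_self hε0.ne', hS_sign 1 (by simp)]
    norm_num
  have hwm : Measurable (ω ε) := hωW ▸ HW.continuous.measurable.comp hdc.measurable
  have hw0 x : 0 ≤ ω ε x := by rw [hωW]; exact HW.nonneg _
  have hw1 x : ω ε x ≤ 1 := by rw [hωW]; exact HW.le_one _
  have hVD : {x | |dD x| < ε} ⊆ Dt ε := by
    rw [hDt]
    exact fun x (hx : |dD x| < ε) => (le_abs_self _).trans_lt hx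
  have hVΓ : {x | |dD x| < ε} ⊆ Γ ε := by
    rw [hΓ]
    refine fun x hx => ⟨hVD hx, fun hcl => ?_⟩
    have hsub : closure (Dt (-ε)) ⊆ {x | dD x ≤ -ε} := by
      refine closure_minimal ?_ (isClosed_le hdc continuous_const)
      rw [hDt]
      exact fun x (hx : dD x < -ε) => hx.le
    exact (abs_lt.1 (show |dD x| < ε from hx)).1.not_ge (hsub hcl)
  have hDt_fin : volume (Dt ε) < ⊤ := by
    rw [hDt]
    exact volume_orientedDist_lt_lt_top hD_bdd hD_ne hdD hε0.le
  have : IsFiniteMeasure (wMeas (Dt ε) (ω ε)) := ⟨(wMeas_univ_le hw1).trans_lt hDt_fin⟩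
  obtain ⟨hnorm_h, hnorm_dh⟩ := ENNReal.add_lt_top.1 hnorm
  have hmd : Measurable (fderiv ℝ h) := measurable_fderiv ℝ h
  have hI : Integrable h (wMeas (Dt ε) (ω ε)) :=
    MemLp.integrable hp ⟨hh.aestronglyMeasurable, hnorm_h⟩
  have hdI : Integrable (fderiv ℝ h) (wMeas (Dt ε) (ω ε)) :=
    MemLp.integrable hp ⟨hmd.aestronglyMeasurable, by rwa [eLpNorm_norm] at hnorm_dh⟩
  have hIV := hI.mono_measure (wMeas_mono hVD)
  have hdIV := hdI.mono_measure (wMeas_mono hVD)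
  have hi := (integrable_wMeas_iff hwm hw0).1 hI
  have hiV := (integrable_wMeas_iff hwm hw0).1 hIV
  have hdiV := (integrable_wMeas_iff hwm hw0).1 hdIV
  have h1 := eLpNorm_one_wMeas hwm hw0 hIV
  have h2 := eLpNorm_one_wMeas hwm hw0 hdIV
  have hμ : wMeas {x | |dD x| < ε} (ω ε) univ ≤ ENNReal.ofReal (C₂ * ε) :=
    (wMeas_univ_le hw1).trans (hvol ε hε)
  have hH1 := eLpNorm_one_le_ofReal_mul_eLpNorm (wMeas_mono (w := ω ε) hVΓ) hp
    (by positivity) hμ hh.aestronglyMeasurable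
  have hH2 := eLpNorm_one_le_ofReal_mul_eLpNorm (wMeas_mono (w := ω ε) hVΓ) hp
    (by positivity) hμ hmd.aestronglyMeasurable
  have hD_eq : D = {x | dD x < 0} :=
    Set.ext fun x => mem_iff_orientedDist_neg hD_open hDc hdD x
  have hΩ_sub : {x | dD x < ε} ⊆ Ω := fun x (hx : dD x < ε) =>
    hΩD (subset_closure (by rw [hDt]; exact hx.trans_le hε.2))
  simp only [hωW, smul_eq_mul, mul_comm (W _), hDt] at hi hiV hdiV h1 h2
  have hE := HW.volumeError_eq hW1 hε0 hdc.measurable hΩ_open.measurableSet hΩ_sub hh hi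
  have hest' := hest ε hε0 W HW h hh (fun x hx => hhd x (hVD hx)) hiV hdiV
  have hE' : (∫ x in Ω, h x * ω ε x) - ∫ x in D, h x =
      ∫ x in {x | |dD x| < ε}, h x * profileDefect W (dD x) := by
    rw [← hE, ← hD_eq, hωW]
  have hconst : C₁ * ε * (C₂ * ε) ^ (1 - (1 / p).toReal) =
      C₁ * C₂ ^ (1 - (1 / p).toReal) * ε ^ (2 - (1 / p).toReal) := by
    rw [Real.mul_rpow hC₂.le hε0.le,
      show 2 - (1 / p).toReal = 1 + (1 - (1 / p).toReal) by ring, Real.rpow_add hε0,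
      Real.rpow_one]
    ring
  rw [hE', ← hconst, ENNReal.ofReal_mul (p := C₁ * ε) (by positivity), mul_assoc, mul_add]
  refine (ENNReal.ofReal_le_ofReal hest').trans ?_
  rw [ENNReal.ofReal_mul (by positivity), ENNReal.ofReal_add
    (integral_nonneg fun x => abs_nonneg _) (integral_nonneg fun x => norm_nonneg _)]
  gcongr
  · refine le_trans (le_of_eq ?_) hH1
    rw [hωW, h1]
    rfl
  · rw [eLpNorm_norm]
    refine le_trans (le_of_eq ?_) hH2
    rw [hωW, h2]
end
end

section
/- Let 0 < ε ≤ ε₀ and let h ∈ C^{0,ν}(closure(Γ_ε)) for some 0 < ν ≤ 1. Then there exists a constant C > 0 independent of ε such that the diffuse volume error satisfies |E_V(h)| = |∫_Ω h ω^ε dx − ∫_D h dx| ≤ C ‖h‖_{C^{0,ν}(closure(Γ_ε))} ε^{ν+1}. -/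
open MeasureTheory ENNReal Set Filter Topology
open scoped RealInnerProductSpace

noncomputable section

theorem eq_norm_smul_of_inner_eq_norm {E : Type*} [NormedAddCommGroup E] [InnerProductSpace ℝ E]
    {v g : E} (hg : ‖g‖ = 1) (h : ⟪g, v⟫ = ‖v‖) :
    v = ‖v‖ • g := by
  have := (inner_eq_norm_mul_iff_real (x := g) (y := v)).1 (by rw [h, hg, one_mul])
  rwa [hg, one_smul, eq_comm] at this

section Eikonal

variable {E : Type*} [NormedAddCommGroup E] [InnerProductSpace ℝ E] [CompleteSpace E]
  {f : E → ℝ} {G : E → E} {r L : ℝ}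

/-- If a `1`-Lipschitz function grows at unit rate between `x` and `y`, it does so along the whole
segment, and so does its differential at each point of the segment. -/
theorem inner_gradient_eq_norm_of_sub_eq_norm (hf : LipschitzWith 1 f) {x y g : E} {t : ℝ}
    (ht : t ∈ Icc (0 : ℝ) 1) (hxy : f y - f x = ‖y - x‖)
    (hg : HasGradientAt f g (x + t • (y - x))) : ⟪g, y - x⟫ = ‖y - x‖ := by
  have hval : ∀ τ ∈ Icc (0 : ℝ) 1, f (x + τ • (y - x)) = f x + τ * ‖y - x‖ := by
    intro τ hτ
    have h1 := hf.dist_le_mul (x + τ • (y - x)) x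
    have h2 := hf.dist_le_mul y (x + τ • (y - x))
    rw [Real.dist_eq, dist_eq_norm, NNReal.coe_one, one_mul] at h1 h2
    have e1 : x + τ • (y - x) - x = τ • (y - x) := by abel
    have e2 : y - (x + τ • (y - x)) = (1 - τ) • (y - x) := by module
    rw [e1, norm_smul, Real.norm_eq_abs, abs_of_nonneg hτ.1] at h1
    rw [e2, norm_smul, Real.norm_eq_abs, abs_of_nonneg (sub_nonneg.2 hτ.2)] at h2
    have h1' := (abs_le.1 h1).2
    have h2' := (abs_le.1 h2).2
    nlinarith
  have hline : HasDerivAt (fun τ : ℝ => x + τ • (y - x)) (y - x) t := by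
    simpa using ((hasDerivAt_id t).smul_const (y - x)).const_add x
  have hd1 : HasDerivWithinAt (fun τ : ℝ => f (x + τ • (y - x))) ⟪g, y - x⟫ (Icc 0 1) t := by
    have := (hg.hasFDerivAt.comp_hasDerivAt t hline).hasDerivWithinAt (s := Icc 0 1)
    rw [InnerProductSpace.toDual_apply_apply] at this
    exact this
  have hd2 : HasDerivWithinAt (fun τ : ℝ => f (x + τ • (y - x))) ‖y - x‖ (Icc 0 1) t := by
    have : HasDerivAt (fun τ : ℝ => f x + τ * ‖y - x‖) ‖y - x‖ t := by
      simpa using ((hasDerivAt_id t).mul_const ‖y - x‖).const_add (f x)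
    exact this.hasDerivWithinAt.congr hval (hval t ht)
  exact (uniqueDiffOn_Icc zero_lt_one t ht).eq_deriv _ hd1 hd2

/-- `f` is a `1`-Lipschitz function solving the eikonal equation `|∇f| = 1` in `{|f| < r}`, where
its gradient `G` is `L`-Lipschitz. -/
structure IsEikonal (f : E → ℝ) (G : E → E) (r L : ℝ) : Prop where
  lipschitz : LipschitzWith 1 f
  nonneg : 0 ≤ L
  hasGradientAt : ∀ x, |f x| < r → HasGradientAt f (G x) x
  norm_eq_one : ∀ x, |f x| < r → ‖G x‖ = 1
  norm_sub_le : ∀ x y, |f x| < r → |f y| < r → ‖G x - G y‖ ≤ L * ‖x - y‖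

namespace IsEikonal

theorem neg (h : IsEikonal f G r L) : IsEikonal (fun x => -f x) (fun x => -G x) r L where
  lipschitz := h.lipschitz.neg
  nonneg := h.nonneg
  hasGradientAt x hx := by
    have := (h.hasGradientAt x (by simpa using hx)).hasFDerivAt.neg
    rw [hasGradientAt_iff_hasFDerivAt, map_neg]
    exact this
  norm_eq_one x hx := by simpa using h.norm_eq_one x (by simpa using hx)
  norm_sub_le x y hx hy := by
    rw [neg_sub_neg, norm_sub_rev]
    exact h.norm_sub_le x y (by simpa using hx) (by simpa using hy)

theorem abs_sub_le (h : IsEikonal f G r L) (x y : E) : |f y - f x| ≤ ‖y - x‖ := by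
  simpa [Real.dist_eq, dist_eq_norm] using h.lipschitz.dist_le_mul y x

theorem abs_lt_of_norm_sub_le (h : IsEikonal f G r L) {x y : E} {s : ℝ} (hs : |f x| + s < r)
    (hy : ‖y - x‖ ≤ s) : |f y| < r := by
  have h1 := h.abs_sub_le x y
  have h2 := abs_sub_abs_le_abs_sub (f y) (f x)
  linarith

theorem abs_sub_sub_inner_le (h : IsEikonal f G r L) {x y : E} (hxy : |f x| + ‖y - x‖ < r) :
    |f y - f x - ⟪G x, y - x⟫| ≤ L * ‖y - x‖ ^ 2 := by
  have hx : |f x| < r := by linarith [norm_nonneg (y - x)]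
  have key := (convex_closedBall x ‖y - x‖).norm_image_sub_le_of_norm_hasFDerivWithin_le'
    (f := f) (f' := fun z => InnerProductSpace.toDual ℝ E (G z))
    (φ := InnerProductSpace.toDual ℝ E (G x)) (C := L * ‖y - x‖) (x := x) (y := y)
    (fun z hz => (h.hasGradientAt z (h.abs_lt_of_norm_sub_le hxy
      (by simpa [dist_eq_norm] using hz))).hasFDerivAt.hasFDerivWithinAt)
    (fun z hz => by
      rw [← map_sub, LinearIsometryEquiv.norm_map]
      have hz' : ‖z - x‖ ≤ ‖y - x‖ := by simpa [dist_eq_norm] using hz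
      exact (h.norm_sub_le z x (h.abs_lt_of_norm_sub_le hxy hz') hx).trans
        (mul_le_mul_of_nonneg_left hz' h.nonneg))
    (by simp) (by simp [dist_eq_norm])
  rw [Real.norm_eq_abs, InnerProductSpace.toDual_apply_apply] at key
  linarith [key, mul_assoc L ‖y - x‖ ‖y - x‖, sq ‖y - x‖]

/-- Explicit Euler scheme for the gradient flow of `f`. -/
theorem exists_euler (h : IsEikonal f G r L) {x : E} {τ : ℝ} (hτ : 0 ≤ τ) (N : ℕ)
    (hs : |f x| + N * τ < r) :
    ∃ y, ‖y - x‖ ≤ N * τ ∧ f x + N * τ - N * (L * τ ^ 2) ≤ f y := by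
  induction N with
  | zero => exact ⟨x, by simp, by simp⟩
  | succ k ih =>
    push_cast at hs ⊢
    obtain ⟨y, hy, hfy⟩ := ih (by linarith)
    have hyr : |f y| + τ < r := by
      have h1 := h.abs_sub_le x y
      have h2 := abs_sub_abs_le_abs_sub (f y) (f x)
      linarith
    have hG : ‖G y‖ = 1 := h.norm_eq_one y (by linarith)
    have e : y + τ • G y - y = τ • G y := by abel
    have hn : ‖y + τ • G y - y‖ = τ := by
      rw [e, norm_smul, hG, mul_one, Real.norm_eq_abs, abs_of_nonneg hτ]
    have h3 := h.abs_sub_sub_inner_le (x := y) (y := y + τ • G y) (by rwa [hn])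
    rw [hn, e, inner_smul_right, real_inner_self_eq_norm_sq, hG] at h3
    refine ⟨y + τ • G y, ?_, ?_⟩
    · calc ‖y + τ • G y - x‖ = ‖(y - x) + (y + τ • G y - y)‖ := by congr 1; abel
        _ ≤ ‖y - x‖ + ‖y + τ • G y - y‖ := norm_add_le _ _
        _ ≤ (k + 1) * τ := by rw [hn]; linarith
    · have := (abs_le.1 h3).1
      linarith

theorem flow_of_nonneg [ProperSpace E] (h : IsEikonal f G r L) {x : E} {s : ℝ} (hs : 0 ≤ s)
    (hsr : |f x| + s < r) : f (x + s • G x) = f x + s ∧ G (x + s • G x) = G x := by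
  rcases hs.eq_or_lt with rfl | hs0
  · simp
  obtain ⟨y, hy, hmax⟩ := (isCompact_closedBall x s).exists_isMaxOn ⟨x, by simp [hs]⟩
    h.lipschitz.continuous.continuousOn
  rw [Metric.mem_closedBall, dist_eq_norm] at hy
  have hge : f x + s ≤ f y := by
    have hlim : Tendsto (fun N : ℕ => f x + s - L * s ^ 2 * (1 / ((N : ℝ) + 1))) atTop
        (𝓝 (f x + s - L * s ^ 2 * 0)) :=
      (tendsto_one_div_add_atTop_nhds_zero_nat.const_mul _).const_sub _
    rw [mul_zero, sub_zero] at hlim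
    refine le_of_tendsto' hlim fun N => ?_
    have hN : (0 : ℝ) < (N : ℝ) + 1 := by positivity
    have e : ((N + 1 : ℕ) : ℝ) * (s / ((N : ℝ) + 1)) = s := by push_cast; field_simp
    obtain ⟨z, hz, hfz⟩ := h.exists_euler (x := x) (τ := s / ((N : ℝ) + 1)) (by positivity) (N + 1)
      (by rwa [e])
    rw [e] at hz hfz
    have e2 : ((N + 1 : ℕ) : ℝ) * (L * (s / ((N : ℝ) + 1)) ^ 2)
        = L * s ^ 2 * (1 / ((N : ℝ) + 1)) := by
      push_cast; field_simp
    rw [e2] at hfz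
    exact hfz.trans (hmax (by simpa [dist_eq_norm] using hz))
  have hle := (abs_le.1 (h.abs_sub_le x y)).2
  have hn : ‖y - x‖ = s := by linarith
  have hfy : f y - f x = ‖y - x‖ := by linarith
  have hxr : |f x| < r := by linarith
  have hyr : |f y| < r := h.abs_lt_of_norm_sub_le hsr hy
  have hGx := eq_norm_smul_of_inner_eq_norm (h.norm_eq_one x hxr)
    (inner_gradient_eq_norm_of_sub_eq_norm h.lipschitz (t := 0) (by simp) hfy
      (by simpa using h.hasGradientAt x hxr))
  have hGy := eq_norm_smul_of_inner_eq_norm (h.norm_eq_one y hyr)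
    (inner_gradient_eq_norm_of_sub_eq_norm h.lipschitz (t := 1) (by simp) hfy
      (by simpa using h.hasGradientAt y hyr))
  rw [hn] at hGx hGy
  have hy' : x + s • G x = y := by rw [← hGx]; abel
  rw [hy']
  refine ⟨by linarith, ?_⟩
  exact smul_right_injective E hs0.ne' (hGy.symm.trans hGx)

/-- Integral curves of the gradient are straight lines of unit speed, along which the gradient is
constant. -/
theorem flow [ProperSpace E] (h : IsEikonal f G r L) {x : E} {s : ℝ} (hsr : |f x| + |s| < r) :
    f (x + s • G x) = f x + s ∧ G (x + s • G x) = G x := by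
  rcases le_total 0 s with hs | hs
  · exact h.flow_of_nonneg hs (by rwa [abs_of_nonneg hs] at hsr)
  · have := h.neg.flow_of_nonneg (x := x) (s := -s) (by linarith)
      (by rwa [abs_of_nonpos hs, ← abs_neg (f x)] at hsr)
    simp only [smul_neg, neg_smul, neg_neg, neg_inj] at this
    exact ⟨by linarith [this.1], this.2⟩

theorem lipschitzOnWith_sub_smul (h : IsEikonal f G r L) {s : ℝ} (hs : |s| * L ≤ 1) :
    LipschitzOnWith 2 (fun x => x - s • G x) {x | |f x| < r} := by
  refine LipschitzOnWith.of_dist_le_mul fun x hx y hy => ?_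
  rw [dist_eq_norm, dist_eq_norm, NNReal.coe_ofNat]
  have e : x - s • G x - (y - s • G y) = (x - y) - s • (G x - G y) := by module
  have h1 : ‖s • (G x - G y)‖ ≤ 1 * ‖x - y‖ := by
    rw [norm_smul, Real.norm_eq_abs]
    calc |s| * ‖G x - G y‖ ≤ |s| * (L * ‖x - y‖) :=
          mul_le_mul_of_nonneg_left (h.norm_sub_le x y hx hy) (abs_nonneg s)
      _ = |s| * L * ‖x - y‖ := by ring
      _ ≤ _ := mul_le_mul_of_nonneg_right hs (norm_nonneg _)
  have h2 := _root_.norm_sub_le (x - y) (s • (G x - G y))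
  rw [e]
  linarith

end IsEikonal

/-- Reflection across the zero level set along the gradient direction. -/
def levelReflection {E : Type*} [AddCommGroup E] [Module ℝ E] (f : E → ℝ) (G : E → E) (x : E) :
    E :=
  x + (-(2 * f x)) • G x

namespace IsEikonal

theorem apply_levelReflection [ProperSpace E] (h : IsEikonal f G r L) {x : E}
    (hx : 3 * |f x| < r) :
    f (levelReflection f G x) = -f x ∧ G (levelReflection f G x) = G x := by
  have := h.flow (x := x) (s := -(2 * f x)) (by rw [abs_neg, abs_mul, abs_two]; linarith)
  exact ⟨by rw [levelReflection, this.1]; ring, this.2⟩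

theorem levelReflection_levelReflection [ProperSpace E] (h : IsEikonal f G r L) {x : E}
    (hx : 3 * |f x| < r) : levelReflection f G (levelReflection f G x) = x := by
  obtain ⟨h1, h2⟩ := h.apply_levelReflection hx
  rw [levelReflection, h1, h2, levelReflection]
  module

theorem norm_levelReflection_sub_self (h : IsEikonal f G r L) {x : E} (hx : |f x| < r) :
    ‖levelReflection f G x - x‖ = 2 * |f x| := by
  rw [levelReflection, add_sub_cancel_left, norm_smul, h.norm_eq_one x hx]
  simp

theorem norm_levelReflection_sub_le (h : IsEikonal f G r L) {x y : E} {ε : ℝ} (hε : 3 * ε ≤ r)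
    (hx : |f x| < ε) (hy : |f y| < ε) (hxy : ‖x - y‖ ≤ ε) :
    ‖levelReflection f G x - levelReflection f G y‖ ≤ (1 + 4 * L * ε) * ‖x - y‖ := by
  have hε0 : 0 < ε := (abs_nonneg _).trans_lt hx
  have hG := h.norm_eq_one x (by linarith)
  have hGG := h.norm_sub_le x y (by linarith) (by linarith)
  have hq := h.abs_sub_sub_inner_le (x := x) (y := y) (by rw [norm_sub_rev]; linarith)
  have e : levelReflection f G x - levelReflection f G y
      = ((x - y) - (2 * ⟪G x, x - y⟫) • G x)
        + ((2 * (f y - f x - ⟪G x, y - x⟫)) • G x + (-(2 * f y)) • (G x - G y)) := by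
    have : ⟪G x, y - x⟫ = -⟪G x, x - y⟫ := by rw [← inner_neg_right, neg_sub]
    rw [this, levelReflection, levelReflection]
    module
  have n1 : ‖(x - y) - (2 * ⟪G x, x - y⟫) • G x‖ = ‖x - y‖ := by
    rw [← sq_eq_sq₀ (norm_nonneg _) (norm_nonneg _), norm_sub_sq_real, norm_smul, inner_smul_right,
      hG, real_inner_comm, Real.norm_eq_abs, mul_one, sq_abs]
    ring
  have n2 : ‖(2 * (f y - f x - ⟪G x, y - x⟫)) • G x‖ ≤ 2 * (L * ε * ‖x - y‖) := by
    rw [norm_smul, hG, mul_one, Real.norm_eq_abs, abs_mul, abs_two]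
    rw [norm_sub_rev y x] at hq
    have : L * ‖x - y‖ ^ 2 ≤ L * ε * ‖x - y‖ := by
      rw [sq, mul_assoc]
      exact mul_le_mul_of_nonneg_left
        (mul_le_mul_of_nonneg_right hxy (norm_nonneg _)) h.nonneg
    linarith
  have n3 : ‖(-(2 * f y)) • (G x - G y)‖ ≤ 2 * (L * ε * ‖x - y‖) := by
    rw [norm_smul, Real.norm_eq_abs, abs_neg, abs_mul, abs_two]
    have : |f y| * ‖G x - G y‖ ≤ ε * (L * ‖x - y‖) :=
      mul_le_mul hy.le hGG (norm_nonneg _) hε0.le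
    linarith
  rw [e]
  have t1 := norm_add_le ((x - y) - (2 * ⟪G x, x - y⟫) • G x)
    ((2 * (f y - f x - ⟪G x, y - x⟫)) • G x + (-(2 * f y)) • (G x - G y))
  have t2 := norm_add_le ((2 * (f y - f x - ⟪G x, y - x⟫)) • G x) ((-(2 * f y)) • (G x - G y))
  linarith

end IsEikonal

end Eikonal

section Volume

variable {E : Type*} [NormedAddCommGroup E] [NormedSpace ℝ E] [FiniteDimensional ℝ E]
  [MeasurableSpace E] [BorelSpace E] (μ : Measure E) [μ.IsAddHaarMeasure]

theorem LipschitzOnWith.addHaar_image_le {c : NNReal} {F : E → E} {A : Set E}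
    (hF : LipschitzOnWith c F A) : μ (F '' A) ≤ (c : ℝ≥0∞) ^ Module.finrank ℝ E * μ A := by
  have hμ := Measure.isAddLeftInvariant_eq_smul μ (μH[Module.finrank ℝ E] : Measure E)
  have key := hF.hausdorffMeasure_image_le (d := Module.finrank ℝ E) (by positivity)
  rw [ENNReal.rpow_natCast] at key
  rw [hμ, Measure.smul_apply, Measure.smul_apply, ENNReal.smul_def, ENNReal.smul_def, smul_eq_mul,
    smul_eq_mul, mul_left_comm]
  gcongr

/-- A map which is `c`-Lipschitz at scale `δ` increases volumes at most by the factor `c ^ n`. -/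
theorem addHaar_image_le_of_locally_lipschitz {c : NNReal} {F : E → E} {A : Set E} {δ : ℝ}
    (hδ : 0 < δ) (hA : MeasurableSet A)
    (hF : ∀ x ∈ A, ∀ y ∈ A, dist x y ≤ δ → dist (F x) (F y) ≤ c * dist x y) :
    μ (F '' A) ≤ (c : ℝ≥0∞) ^ Module.finrank ℝ E * μ A := by
  let B : ℕ → Set E := fun k => Metric.ball (TopologicalSpace.denseSeq E k) (δ / 2)
  have hB : ⋃ k, disjointed B k = univ := by
    rw [iUnion_disjointed, eq_univ_iff_forall]
    intro x
    obtain ⟨k, hk⟩ := (TopologicalSpace.denseRange_denseSeq E).exists_dist_lt x (half_pos hδ)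
    exact mem_iUnion.2 ⟨k, hk⟩
  have hBm : ∀ k, MeasurableSet (disjointed B k) :=
    MeasurableSet.disjointed fun k => measurableSet_ball
  have hcover : ⋃ k, A ∩ disjointed B k = A := by rw [← inter_iUnion, hB, inter_univ]
  have hpiece : ∀ k, μ (F '' (A ∩ disjointed B k))
      ≤ (c : ℝ≥0∞) ^ Module.finrank ℝ E * μ (A ∩ disjointed B k) := by
    intro k
    refine LipschitzOnWith.addHaar_image_le μ
      (LipschitzOnWith.of_dist_le_mul fun x hx y hy => hF x hx.1 y hy.1 ?_)
    have h1 : dist x _ < δ / 2 := disjointed_subset B k hx.2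
    have h2 : dist y _ < δ / 2 := disjointed_subset B k hy.2
    linarith [dist_triangle_right x y (TopologicalSpace.denseSeq E k)]
  calc μ (F '' A) = μ (⋃ k, F '' (A ∩ disjointed B k)) := by rw [← image_iUnion, hcover]
    _ ≤ ∑' k, μ (F '' (A ∩ disjointed B k)) := measure_iUnion_le _
    _ ≤ ∑' k, (c : ℝ≥0∞) ^ Module.finrank ℝ E * μ (A ∩ disjointed B k) :=
      ENNReal.tsum_le_tsum hpiece
    _ = (c : ℝ≥0∞) ^ Module.finrank ℝ E * μ A := by
      rw [ENNReal.tsum_mul_left, ← measure_iUnion _ (fun k => hA.inter (hBm k)), hcover]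
      exact fun i j hij => (disjoint_disjointed B hij).mono inter_subset_right inter_subset_right

end Volume

section Tube

variable {E : Type*} [NormedAddCommGroup E] [InnerProductSpace ℝ E] [FiniteDimensional ℝ E]
  [MeasurableSpace E] [BorelSpace E] (μ : Measure E) [μ.IsAddHaarMeasure]
  {f : E → ℝ} {G : E → E} {r L : ℝ}

namespace IsEikonal

theorem measure_tube_le_shift (h : IsEikonal f G r L) {δ s : ℝ} (hs : |s| * L ≤ 1)
    (hδ : δ + |s| ≤ r) :
    μ {x | |f x| < δ} ≤ 2 ^ Module.finrank ℝ E * μ (f ⁻¹' Ioo (s - δ) (s + δ)) := by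
  have hsub : f ⁻¹' Ioo (s - δ) (s + δ) ⊆ {x | |f x| < r} := by
    rintro x ⟨h1, h2⟩
    rw [mem_ofPred_eq, abs_lt]
    have := abs_le.1 (le_refl |s|)
    constructor <;> linarith
  have key := ((h.lipschitzOnWith_sub_smul hs).mono hsub).addHaar_image_le μ
  refine (measure_mono fun x hx => ?_).trans key
  have hx' : |f x| < δ := hx
  obtain ⟨h1, h2⟩ := h.flow (x := x) (s := s) (by linarith)
  refine ⟨x + s • G x, ?_, by simp [h2]⟩
  rw [mem_preimage, h1]
  have := abs_lt.1 hx'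
  constructor <;> linarith

/-- Tubular neighborhoods of the zero level set have volume of the order of their width. -/
theorem exists_measure_tube_le (h : IsEikonal f G r L) (hr : 0 < r)
    (hfin : μ {x | |f x| < r} ≠ ∞) :
    ∃ V ρ : ℝ, 0 ≤ V ∧ 0 < ρ ∧ ∀ δ, 0 < δ → δ ≤ ρ → μ.real {x | |f x| < δ} ≤ V * δ := by
  have hL := h.nonneg
  set ρ : ℝ := min (r / 2) (1 / (L + 1)) with hρdef
  have hρ : 0 < ρ := by positivity
  have hρr : 2 * ρ ≤ r := by linarith [min_le_left (r / 2) (1 / (L + 1))]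
  have hρL : ρ * L ≤ 1 := by
    have h1 : ρ * L ≤ 1 / (L + 1) * L := mul_le_mul_of_nonneg_right (min_le_right _ _) hL
    refine h1.trans ?_
    rw [one_div_mul_eq_div, div_le_one (by linarith)]
    linarith
  set W : ℝ := 2 ^ Module.finrank ℝ E * μ.real {x | |f x| < r} with hW
  refine ⟨2 * W / ρ, ρ, by positivity, hρ, fun δ hδ hδρ => ?_⟩
  set N : ℕ := ⌊ρ / (2 * δ)⌋₊
  have hNle : (N : ℝ) * (2 * δ) ≤ ρ := by
    rw [← le_div_iff₀ (by positivity)]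
    exact Nat.floor_le (by positivity)
  have hNlt : ρ < (N + 1 : ℝ) * (2 * δ) := by
    rw [← div_lt_iff₀ (by positivity)]
    exact Nat.lt_floor_add_one _
  let A : ℕ → Set E := fun k => f ⁻¹' Ioo (k * (2 * δ) - δ) (k * (2 * δ) + δ)
  have hk : ∀ k ∈ Finset.range (N + 1), (k : ℝ) * (2 * δ) ≤ ρ := by
    intro k hk
    have : (k : ℝ) ≤ N := by exact_mod_cast Nat.lt_succ_iff.1 (Finset.mem_range.1 hk)
    exact (mul_le_mul_of_nonneg_right this (by positivity)).trans hNle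
  have habs : ∀ k : ℕ, |(k : ℝ) * (2 * δ)| = k * (2 * δ) := fun k => abs_of_nonneg (by positivity)
  have hAr : ⋃ k ∈ Finset.range (N + 1), A k ⊆ {x | |f x| < r} := by
    refine iUnion₂_subset fun k hk' x hx => ?_
    have h1 := hk k hk'
    have h2 : 0 ≤ (k : ℝ) * (2 * δ) := by positivity
    rw [mem_ofPred_eq, abs_lt]
    constructor <;> linarith [hx.1, hx.2]
  have hdisj : PairwiseDisjoint (↑(Finset.range (N + 1)) : Set ℕ) A := by
    have aux : ∀ i j : ℕ, i < j → Disjoint (A i) (A j) := by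
      intro i j hij
      rw [Set.disjoint_left]
      intro x hx hx'
      have : (i : ℝ) + 1 ≤ j := by exact_mod_cast hij
      have := mul_le_mul_of_nonneg_right this (by positivity : 0 ≤ 2 * δ)
      linarith [hx.2, hx'.1]
    intro i _ j _ hij
    rcases lt_or_gt_of_ne hij with h' | h'
    · exact aux i j h'
    · exact (aux j i h').symm
  have hAm : ∀ k ∈ Finset.range (N + 1), MeasurableSet (A k) := fun k _ =>
    (isOpen_Ioo.preimage h.lipschitz.continuous).measurableSet
  have hsum : (N + 1 : ℝ≥0∞) * μ {x | |f x| < δ}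
      ≤ 2 ^ Module.finrank ℝ E * μ {x | |f x| < r} := by
    calc (N + 1 : ℝ≥0∞) * μ {x | |f x| < δ}
        = ∑ k ∈ Finset.range (N + 1), μ {x | |f x| < δ} := by simp
      _ ≤ ∑ k ∈ Finset.range (N + 1), 2 ^ Module.finrank ℝ E * μ (A k) := by
          refine Finset.sum_le_sum fun k hk' => h.measure_tube_le_shift μ ?_ ?_
          · rw [habs]
            exact (mul_le_mul_of_nonneg_right (hk k hk') hL).trans hρL
          · rw [habs]
            linarith [hk k hk']
      _ = 2 ^ Module.finrank ℝ E * μ (⋃ k ∈ Finset.range (N + 1), A k) := by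
          rw [← Finset.mul_sum, measure_biUnion_finset hdisj hAm]
      _ ≤ _ := by gcongr
  have hreal : (N + 1 : ℝ) * μ.real {x | |f x| < δ} ≤ W := by
    have := ENNReal.toReal_mono (ENNReal.mul_ne_top (by simp) hfin) hsum
    rw [ENNReal.toReal_mul, ENNReal.toReal_mul] at this
    simpa [hW, Measure.real, ENNReal.toReal_add] using this
  have hm : 0 ≤ μ.real {x | |f x| < δ} := measureReal_nonneg
  have h1 : ρ * μ.real {x | |f x| < δ} ≤ 2 * δ * W := by
    calc ρ * μ.real {x | |f x| < δ} ≤ (N + 1 : ℝ) * (2 * δ) * μ.real {x | |f x| < δ} :=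
          mul_le_mul_of_nonneg_right hNlt.le hm
      _ = 2 * δ * ((N + 1 : ℝ) * μ.real {x | |f x| < δ}) := by ring
      _ ≤ _ := mul_le_mul_of_nonneg_left hreal (by positivity)
  rw [div_mul_eq_mul_div, le_div_iff₀ hρ]
  linarith

theorem measure_zero_level_eq_zero (h : IsEikonal f G r L) (hr : 0 < r)
    (hfin : μ {x | |f x| < r} ≠ ∞) : μ {x | f x = 0} = 0 := by
  obtain ⟨V, ρ, hV, hρ, hle⟩ := h.exists_measure_tube_le μ hr hfin
  have hsub : ∀ δ : ℝ, 0 < δ → {x | f x = 0} ⊆ {x | |f x| < δ} := fun δ hδ x hx => by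
    have hx' : f x = 0 := hx
    simpa [hx'] using hδ
  have hfin0 : μ {x | f x = 0} ≠ ∞ := ((measure_mono (hsub r hr)).trans_lt hfin.lt_top).ne
  have key : ∀ δ, 0 < δ → δ ≤ min r ρ → μ.real {x | f x = 0} ≤ V * δ := fun δ hδ hδr =>
    (measureReal_mono (hsub δ hδ) (ne_top_of_le_ne_top hfin (measure_mono fun x hx =>
      lt_of_lt_of_le hx (hδr.trans (min_le_left _ _))))).trans
      (hle δ hδ (hδr.trans (min_le_right _ _)))
  have hlim : Tendsto (fun δ : ℝ => V * δ) (𝓝[>] 0) (𝓝 (V * 0)) :=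
    (tendsto_id.const_mul V).mono_left nhdsWithin_le_nhds
  rw [mul_zero] at hlim
  have h0 : μ.real {x | f x = 0} ≤ 0 := ge_of_tendsto hlim (by
    filter_upwards [Ioc_mem_nhdsGT (lt_min hr hρ)] with δ hδ using key δ hδ.1 hδ.2)
  rcases (ENNReal.toReal_eq_zero_iff _).1 (le_antisymm h0 measureReal_nonneg) with h' | h'
  · exact h'
  · exact absurd h' hfin0

theorem measurable_levelReflection (h : IsEikonal f G r L) (hG : Measurable G) :
    Measurable (levelReflection f G) :=
  measurable_id.add ((h.lipschitz.continuous.measurable.const_mul 2).neg.smul hG)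

/-- The reflection across the zero level set almost preserves the volume of thin tubes. -/
theorem map_levelReflection_le (h : IsEikonal f G r L) (hG : Measurable G) {ε : ℝ} (hε : 0 < ε)
    (hεr : 3 * ε ≤ r) :
    (μ.restrict {x | |f x| < ε}).map (levelReflection f G)
      ≤ ENNReal.ofReal ((1 + 4 * L * ε) ^ Module.finrank ℝ E) • μ.restrict {x | |f x| < ε} := by
  have hL := h.nonneg
  have hT : MeasurableSet {x | |f x| < ε} :=
    (isOpen_Iio.preimage h.lipschitz.continuous.abs).measurableSet
  have hR := h.measurable_levelReflection hG
  refine Measure.le_iff.2 fun A hA => ?_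
  rw [Measure.map_apply hR hA, Measure.restrict_apply (hR hA), Measure.smul_apply,
    Measure.restrict_apply hA, smul_eq_mul, ENNReal.ofReal_pow (by positivity)]
  refine le_trans (measure_mono ?_) (addHaar_image_le_of_locally_lipschitz μ
    (c := Real.toNNReal (1 + 4 * L * ε)) (F := levelReflection f G) hε (hA.inter hT) ?_)
  · rintro x ⟨hxA, hx⟩
    have hx' : |f x| < ε := hx
    have hx3 : 3 * |f x| < r := by linarith
    refine ⟨levelReflection f G x, ⟨hxA, ?_⟩, h.levelReflection_levelReflection hx3⟩
    simpa [(h.apply_levelReflection hx3).1] using hx'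
  · intro x hx y hy hxy
    rw [dist_eq_norm] at hxy
    rw [Real.coe_toNNReal _ (by positivity), dist_eq_norm, dist_eq_norm]
    exact h.norm_levelReflection_sub_le hεr hx.2 hy.2 hxy

end IsEikonal

end Tube

section Integral

variable {X : Type*} [MeasurableSpace X] {ν : Measure X} [IsFiniteMeasure ν] {R : X → X}
  {g w : X → ℝ} {η K H : ℝ}

theorem abs_integral_sub_integral_comp_le (hR : Measurable R) (hη : 0 ≤ η)
    (hmap : ν.map R ≤ ENNReal.ofReal (1 + η) • ν) (hg : Measurable g) (hK : ∀ᵐ x ∂ν, |g x| ≤ K) :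
    |∫ x, g x ∂ν - ∫ x, g (R x) ∂ν| ≤ 2 * η * K * ν.real univ := by
  set ν' := ν.map R with hν'
  set σ : Measure X := ENNReal.ofReal (1 + η) • ν - ν' with hσ
  have hfs : IsFiniteMeasure (ENNReal.ofReal (1 + η) • ν) := ν.smul_finite ENNReal.ofReal_ne_top
  have hadd : σ + ν' = ENNReal.ofReal (1 + η) • ν := Measure.sub_add_cancel_of_le hmap
  have hσle : σ ≤ ENNReal.ofReal (1 + η) • ν := Measure.sub_le
  have hfσ : IsFiniteMeasure σ := isFiniteMeasure_of_le _ hσle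
  have hint : Integrable g ν := Integrable.of_bound hg.aestronglyMeasurable K hK
  have hints : Integrable g (ENNReal.ofReal (1 + η) • ν) := hint.smul_measure ENNReal.ofReal_ne_top
  have hKσ : ∀ᵐ x ∂σ, ‖g x‖ ≤ K :=
    ((Measure.absolutelyContinuous_of_le hσle).trans Measure.smul_absolutelyContinuous).ae_le hK
  have hsplit : ∫ x, g x ∂σ + ∫ x, g x ∂ν' = (1 + η) * ∫ x, g x ∂ν := by
    rw [← integral_add_measure (hints.mono_measure hσle) (hints.mono_measure hmap), hadd,
      integral_smul_measure, ENNReal.toReal_ofReal (by positivity), smul_eq_mul]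
  have hmass : σ.real univ = η * ν.real univ := by
    have h1 : (σ + ν').real univ = (1 + η) * ν.real univ := by
      rw [hadd, measureReal_ennreal_smul_apply, ENNReal.toReal_ofReal (by positivity)]
    have h2 : ν'.real univ = ν.real univ := by
      rw [hν', map_measureReal_apply hR MeasurableSet.univ, preimage_univ]
    rw [measureReal_add_apply, h2] at h1
    linarith
  have e1 : |∫ x, g x ∂σ| ≤ K * (η * ν.real univ) := by
    rw [← hmass, ← Real.norm_eq_abs]
    exact norm_integral_le_of_norm_le_const hKσ
  have e2 : |∫ x, g x ∂ν| ≤ K * ν.real univ := by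
    rw [← Real.norm_eq_abs]
    exact norm_integral_le_of_norm_le_const hK
  rw [← integral_map hR.aemeasurable hg.aestronglyMeasurable]
  have e3 : |η * ∫ x, g x ∂ν| ≤ η * (K * ν.real univ) := by
    rw [abs_mul, abs_of_nonneg hη]
    exact mul_le_mul_of_nonneg_left e2 hη
  have e4 : ∫ x, g x ∂ν - ∫ x, g x ∂ν' = ∫ x, g x ∂σ - η * ∫ x, g x ∂ν := by linarith
  rw [e4]
  refine (abs_sub _ _).trans ?_
  linarith

/-- Cancellation for a weight which is odd under an almost measure preserving map. -/
theorem abs_integral_mul_le_of_odd (hR : Measurable R) (hη : 0 ≤ η)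
    (hmap : ν.map R ≤ ENNReal.ofReal (1 + η) • ν) (hg : Measurable g) (hw : Measurable w)
    (hK : ∀ᵐ x ∂ν, |g x| ≤ K) (hgR : ∀ᵐ x ∂ν, |g (R x) - g x| ≤ H)
    (hw1 : ∀ x, |w x| ≤ 1) (hwR : ∀ᵐ x ∂ν, w (R x) = -w x) :
    |∫ x, g x * w x ∂ν| ≤ (H + 2 * η * K) * ν.real univ := by
  have hbd : ∀ᵐ x ∂ν, |g x * w x| ≤ K := by
    filter_upwards [hK] with x hx
    rw [abs_mul]
    exact (mul_le_of_le_one_right (abs_nonneg _) (hw1 x)).trans hx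
  have e1 := abs_integral_sub_integral_comp_le hR hη hmap (hg.mul hw) hbd
  have hint : Integrable (fun x => g x * w x) ν :=
    Integrable.of_bound (hg.mul hw).aestronglyMeasurable K hbd
  have hbd2 : ∀ᵐ x ∂ν, ‖(g (R x) - g x) * w x‖ ≤ H := by
    filter_upwards [hgR] with x hx
    rw [Real.norm_eq_abs, abs_mul]
    exact (mul_le_of_le_one_right (abs_nonneg _) (hw1 x)).trans hx
  have hint2 : Integrable (fun x => (g (R x) - g x) * w x) ν :=
    Integrable.of_bound (((hg.comp hR).sub hg).mul hw).aestronglyMeasurable H hbd2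
  have e2 : |∫ x, (g (R x) - g x) * w x ∂ν| ≤ H * ν.real univ := by
    rw [← Real.norm_eq_abs]
    exact norm_integral_le_of_norm_le_const hbd2
  have e3 : ∫ x, g (R x) * w (R x) ∂ν
      = -(∫ x, (g (R x) - g x) * w x ∂ν) - ∫ x, g x * w x ∂ν := by
    have hneg : Integrable (fun x => -((g (R x) - g x) * w x)) ν := hint2.neg
    rw [← integral_neg, ← integral_sub hneg hint]
    refine integral_congr_ae ?_
    filter_upwards [hwR] with x hx
    rw [hx]
    ring
  simp only [Pi.mul_apply] at e1
  rw [e3] at e1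
  rw [abs_le] at e1 e2 ⊢
  have hH : 0 ≤ H * ν.real univ := by linarith
  have hK0 : 0 ≤ 2 * η * K * ν.real univ := by linarith
  constructor <;> linarith

end Integral

section SignedDistance

variable {E : Type*} [NormedAddCommGroup E] {D : Set E} {d : E → ℝ}

theorem signedDist_of_mem (hd : ∀ x, d x = Metric.infDist x D - Metric.infDist x Dᶜ) {x : E}
    (hx : x ∈ D) : d x = -Metric.infDist x Dᶜ := by
  rw [hd, Metric.infDist_zero_of_mem hx, zero_sub]

theorem signedDist_of_notMem (hd : ∀ x, d x = Metric.infDist x D - Metric.infDist x Dᶜ) {x : E}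
    (hx : x ∉ D) : d x = Metric.infDist x D := by
  rw [hd, Metric.infDist_zero_of_mem (s := Dᶜ) hx, sub_zero]

theorem signedDist_neg_iff (hd : ∀ x, d x = Metric.infDist x D - Metric.infDist x Dᶜ)
    (hD : IsOpen D) (hDc : Dᶜ.Nonempty) {x : E} : d x < 0 ↔ x ∈ D := by
  refine ⟨fun h => ?_, fun hx => ?_⟩
  · by_contra hx
    rw [signedDist_of_notMem hd hx] at h
    exact h.not_ge Metric.infDist_nonneg
  · rw [signedDist_of_mem hd hx, neg_lt_zero]
    exact (hD.isClosed_compl.notMem_iff_infDist_pos hDc).1 (not_not.2 hx)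

theorem signedDist_eq_zero_of_mem_frontier
    (hd : ∀ x, d x = Metric.infDist x D - Metric.infDist x Dᶜ) {x : E} (hx : x ∈ frontier D) :
    d x = 0 := by
  rw [frontier_eq_closure_inter_closure] at hx
  rw [hd, Metric.infDist_zero_of_mem_closure hx.1, Metric.infDist_zero_of_mem_closure hx.2,
    sub_zero]

theorem exists_mem_frontier_dist_eq_abs_signedDist [NormedSpace ℝ E] [FiniteDimensional ℝ E]
    (hd : ∀ x, d x = Metric.infDist x D - Metric.infDist x Dᶜ) (hDne : D.Nonempty)
    (hDc : Dᶜ.Nonempty) (x : E) : ∃ y ∈ frontier D, dist x y = |d x| := by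
  by_cases hx : x ∈ D
  · obtain ⟨y, hy, h⟩ := exists_mem_frontier_infDist_compl_eq_dist hx (nonempty_compl.1 hDc)
    exact ⟨y, hy, by
      rw [signedDist_of_mem hd hx, abs_neg, abs_of_nonneg Metric.infDist_nonneg, h]⟩
  · have hne : Dᶜ ≠ univ := nonempty_compl.1 (by rwa [compl_compl])
    obtain ⟨y, hy, h⟩ := exists_mem_frontier_infDist_compl_eq_dist (s := Dᶜ) hx hne
    rw [frontier_compl] at hy
    rw [compl_compl] at h
    exact ⟨y, hy, by
      rw [signedDist_of_notMem hd hx, abs_of_nonneg Metric.infDist_nonneg, h]⟩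

theorem signedDist_lipschitz [NormedSpace ℝ E]
    (hd : ∀ x, d x = Metric.infDist x D - Metric.infDist x Dᶜ) : LipschitzWith 1 d := by
  refine LipschitzWith.of_le_add fun x y => ?_
  by_cases hx : x ∈ D <;> by_cases hy : y ∈ D
  · rw [signedDist_of_mem hd hx, signedDist_of_mem hd hy]
    have := Metric.infDist_le_infDist_add_dist (s := Dᶜ) (x := y) (y := x)
    rw [dist_comm] at this
    linarith
  · rw [signedDist_of_mem hd hx, signedDist_of_notMem hd hy]
    have h1 := Metric.infDist_nonneg (s := Dᶜ) (x := x)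
    have h2 := Metric.infDist_nonneg (s := D) (x := y)
    have h3 := dist_nonneg (x := x) (y := y)
    linarith
  · obtain ⟨z, hz, hz1, hz2⟩ := isPreconnected_closed_iff.1 (convex_segment x y).isPreconnected
      (closure D) (closure Dᶜ) isClosed_closure isClosed_closure
      (fun z _ => (em (z ∈ D)).imp (fun h => subset_closure h) fun h => subset_closure h)
      ⟨y, right_mem_segment ℝ x y, subset_closure hy⟩
      ⟨x, left_mem_segment ℝ x y, subset_closure hx⟩
    have h1 : Metric.infDist x D ≤ dist x z := by
      rw [← Metric.infDist_closure]
      exact Metric.infDist_le_dist_of_mem hz1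
    have h2 : Metric.infDist y Dᶜ ≤ dist y z := by
      rw [← Metric.infDist_closure]
      exact Metric.infDist_le_dist_of_mem hz2
    have h3 := dist_add_dist_of_mem_segment hz
    rw [signedDist_of_notMem hd hx, signedDist_of_mem hd hy]
    rw [dist_comm z y] at h3
    linarith
  · rw [signedDist_of_notMem hd hx, signedDist_of_notMem hd hy]
    exact Metric.infDist_le_infDist_add_dist

end SignedDistance

section SignedDistanceGradient

variable {E : Type*} [NormedAddCommGroup E] [InnerProductSpace ℝ E] [FiniteDimensional ℝ E]
  {D U : Set E} {d : E → ℝ}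

theorem norm_gradient_signedDist_of_ne_zero
    (hd : ∀ x, d x = Metric.infDist x D - Metric.infDist x Dᶜ) (hDne : D.Nonempty)
    (hDc : Dᶜ.Nonempty) {x : E} (hx : DifferentiableAt ℝ d x) (hx0 : d x ≠ 0) :
    ‖gradient d x‖ = 1 := by
  have hlip := signedDist_lipschitz hd
  have hle : ‖gradient d x‖ ≤ 1 := by
    rw [gradient, LinearIsometryEquiv.norm_map]
    exact norm_fderiv_le_of_lipschitz ℝ hlip
  obtain ⟨y, hy, hxy⟩ := exists_mem_frontier_dist_eq_abs_signedDist hd hDne hDc x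
  have hy0 := signedDist_eq_zero_of_mem_frontier hd hy
  have hg := hx.hasGradientAt
  have aux : ∀ v : E, ⟪gradient d x, v⟫ = ‖v‖ → 0 < ‖v‖ → 1 ≤ ‖gradient d x‖ := by
    intro v h1 h2
    have := real_inner_le_norm (gradient d x) v
    rw [h1] at this
    exact (le_mul_iff_one_le_left h2).1 this
  refine le_antisymm hle ?_
  have hpos := abs_pos.2 hx0
  rcases hx0.lt_or_gt with h | h
  · rw [abs_of_neg h, dist_comm, dist_eq_norm] at hxy
    refine aux (y - x) (inner_gradient_eq_norm_of_sub_eq_norm hlip (t := 0) (by simp) ?_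
      (by simpa using hg)) (by linarith)
    linarith
  · rw [abs_of_pos h, dist_eq_norm] at hxy
    refine aux (x - y) (inner_gradient_eq_norm_of_sub_eq_norm hlip (t := 1) (by simp) ?_
      (by simpa using hg)) (by linarith)
    linarith

/-- The signed distance to a `C^{1,1}` boundary solves the eikonal equation near that boundary. -/
theorem exists_isEikonal_signedDist
    (hd : ∀ x, d x = Metric.infDist x D - Metric.infDist x Dᶜ) (hD : IsOpen D)
    (hDb : Bornology.IsBounded D) (hDne : D.Nonempty) (hDc : Dᶜ.Nonempty) (hU : IsOpen U)
    (hUD : frontier D ⊆ U) (hdiff : ContDiffOn ℝ 1 d U) {L : NNReal}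
    (hL : LipschitzOnWith L (fun x => fderiv ℝ d x) U) :
    ∃ r > 0, IsEikonal d (gradient d) r L ∧ Bornology.IsBounded {x | |d x| < r} := by
  have hcomp : IsCompact (frontier D) :=
    Metric.isCompact_of_isClosed_isBounded isClosed_frontier
      (hDb.closure.subset frontier_subset_closure)
  obtain ⟨r, hr, hrU⟩ := hcomp.exists_thickening_subset_open hU hUD
  have hthick : {x | |d x| < r} ⊆ Metric.thickening r (frontier D) := fun x hx => by
    obtain ⟨y, hy, hxy⟩ := exists_mem_frontier_dist_eq_abs_signedDist hd hDne hDc x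
    exact Metric.mem_thickening_iff.2 ⟨y, hy, hxy.trans_lt hx⟩
  have hmem : ∀ x, |d x| < r → x ∈ U := fun x hx => hrU (hthick hx)
  have hda : ∀ x ∈ U, DifferentiableAt ℝ d x := fun x hx =>
    (hdiff.contDiffAt (hU.mem_nhds hx)).differentiableAt (by simp)
  refine ⟨r, hr, ⟨signedDist_lipschitz hd, L.coe_nonneg,
    fun x hx => (hda x (hmem x hx)).hasGradientAt, fun x hx => ?_, fun x y hx hy => ?_⟩,
    hcomp.isBounded.thickening.subset hthick⟩
  · by_cases hx0 : d x = 0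
    · obtain ⟨y, hy, hxy⟩ := exists_mem_frontier_dist_eq_abs_signedDist hd hDne hDc x
      rw [hx0, abs_zero, dist_eq_zero] at hxy
      subst hxy
      have hcont : Tendsto (fun z => ‖gradient d z‖) (𝓝 x) (𝓝 ‖gradient d x‖) := by
        have h1 : ContinuousAt (fun z => fderiv ℝ d z) x :=
          hL.continuousOn.continuousAt (hU.mem_nhds (hmem x hx))
        simp only [gradient, LinearIsometryEquiv.norm_map]
        exact h1.norm
      have hfreq : ∃ᶠ z in 𝓝 x, ‖gradient d z‖ ∈ ({1} : Set ℝ) := by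
        refine ((mem_closure_iff_frequently.1 (frontier_subset_closure hy)).and_eventually
          (hU.mem_nhds (hmem x hx))).mono fun z hz => ?_
        exact norm_gradient_signedDist_of_ne_zero hd hDne hDc (hda z hz.2)
          ((signedDist_neg_iff hd hD hDc).2 hz.1).ne
      exact isClosed_singleton.mem_of_frequently_of_tendsto hfreq hcont
    · exact norm_gradient_signedDist_of_ne_zero hd hDne hDc (hda x (hmem x hx)) hx0
  · rw [gradient, gradient, ← map_sub, LinearIsometryEquiv.norm_map]
    simpa [dist_eq_norm] using hL.dist_le_mul x (hmem x hx) y (hmem y hy)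

theorem measurable_gradient [MeasurableSpace E] [BorelSpace E] (f : E → ℝ) :
    Measurable (gradient f) :=
  (InnerProductSpace.toDual ℝ E).symm.continuous.measurable.comp (measurable_fderiv ℝ f)

end SignedDistanceGradient

section Profile

theorem one_add_pow_le_one_add_two_pow_mul (n : ℕ) {x : ℝ} (h0 : 0 ≤ x) (h1 : x ≤ 1) :
    (1 + x) ^ n ≤ 1 + 2 ^ n * x := by
  induction n with
  | zero => simp [h0]
  | succ k ih =>
    have hk : (1 : ℝ) ≤ 2 ^ k := one_le_pow₀ one_le_two
    calc (1 + x) ^ (k + 1) = (1 + x) ^ k + (1 + x) ^ k * x := by ring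
      _ ≤ (1 + 2 ^ k * x) + 2 ^ k * x := by
        have : (1 + x) ^ k ≤ 2 ^ k := pow_le_pow_left₀ (by linarith) (by linarith) k
        gcongr
      _ = 1 + 2 ^ (k + 1) * x := by ring

variable {S : ℝ → ℝ}

theorem abs_profile_le_one (hS_sign : ∀ t : ℝ, 1 ≤ |t| → S t = t / |t|)
    (hS_odd : ∀ t : ℝ, S (-t) = -S t)
    (hS_nonneg : ∀ t ∈ Ioo (0 : ℝ) 2, 0 ≤ (1 + S (t - 1)) / 2) (t : ℝ) : |S t| ≤ 1 := by
  rcases le_or_gt 1 |t| with h | h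
  · rw [hS_sign t h, abs_div, abs_abs, div_self (by linarith)]
  · have hlow : ∀ s : ℝ, |s| < 1 → -1 ≤ S s := fun s hs => by
      have hs' := abs_lt.1 hs
      have := hS_nonneg (s + 1) ⟨by linarith, by linarith⟩
      rw [add_sub_cancel_right] at this
      linarith
    have h1 := hlow t h
    have h2 := hlow (-t) (by rwa [abs_neg])
    rw [hS_odd] at h2
    exact abs_le.2 ⟨h1, by linarith⟩

end Profile

section DiffuseVolume

variable {E : Type*} [NormedAddCommGroup E] [InnerProductSpace ℝ E] [FiniteDimensional ℝ E]
  [MeasurableSpace E] [BorelSpace E] {μ : Measure E} {f : E → ℝ} {G : E → E} {r L : ℝ}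

/-- A bounded weight supported in a thin tube and odd with respect to the level set function yields
an integral of order `ε ^ (ν + 1)` against `ν`-Hölder functions. -/
theorem IsEikonal.exists_abs_integral_tube_le [μ.IsAddHaarMeasure] (h : IsEikonal f G r L)
    (hG : Measurable G) (hr : 0 < r) (hfin : μ {x | |f x| < r} ≠ ∞) :
    ∃ C ρ : ℝ, 0 ≤ C ∧ 0 < ρ ∧ ∀ ε, 0 < ε → ε ≤ ρ → ∀ ν : ℝ, 0 < ν → ν ≤ 1 →
      ∀ g w : E → ℝ, Measurable g → Measurable w → (∀ x, |w x| ≤ 1) →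
        (∀ x y, |f x| < ε → f y = -f x → f x ≠ 0 → w y = -w x) →
        ∀ K : ℝ, 0 ≤ K → (∀ x, |f x| < ε → |g x| ≤ K) →
          (∀ x y, |f x| < ε → |f y| < ε → |g x - g y| ≤ K * dist x y ^ ν) →
          |∫ x in {x | |f x| < ε}, g x * w x ∂μ| ≤ C * K * ε ^ (ν + 1) := by
  obtain ⟨V, ρ₁, hV, hρ₁, htube⟩ := h.exists_measure_tube_le μ hr hfin
  have hL := h.nonneg
  set N := Module.finrank ℝ E
  set M : ℝ := 2 ^ N * (4 * L) with hM
  have hM0 : 0 ≤ M := by positivity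
  refine ⟨(2 + 2 * M) * V, min (min 1 ρ₁) (min (r / 3) (1 / (4 * L + 1))), by positivity,
    by positivity, fun ε hε hερ ν hν hν1 g w hg hw hw1 hwodd K hK hgK hgH => ?_⟩
  simp only [le_min_iff] at hερ
  obtain ⟨⟨hε1, hερ₁⟩, hεr, hεL⟩ := hερ
  have h3 : 3 * ε ≤ r := by linarith
  have hεL' : 4 * L * ε ≤ 1 := by
    rw [le_div_iff₀ (by positivity)] at hεL
    linarith
  have hT : MeasurableSet {x | |f x| < ε} :=
    (isOpen_Iio.preimage h.lipschitz.continuous.abs).measurableSet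
  have hTfin : μ {x | |f x| < ε} ≠ ∞ :=
    ne_top_of_le_ne_top hfin (measure_mono fun x (hx : |f x| < ε) => by
      change |f x| < r
      linarith)
  have : IsFiniteMeasure (μ.restrict {x | |f x| < ε}) := isFiniteMeasure_restrict.2 hTfin
  have hmap : (μ.restrict {x | |f x| < ε}).map (levelReflection f G)
      ≤ ENNReal.ofReal (1 + M * ε) • μ.restrict {x | |f x| < ε} := by
    refine (h.map_levelReflection_le μ hG hε h3).trans (Measure.le_iff.2 fun A _ => ?_)
    rw [Measure.smul_apply, Measure.smul_apply, smul_eq_mul, smul_eq_mul]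
    gcongr
    calc (1 + 4 * L * ε) ^ N ≤ 1 + 2 ^ N * (4 * L * ε) :=
          one_add_pow_le_one_add_two_pow_mul _ (by positivity) hεL'
      _ = 1 + M * ε := by rw [hM]; ring
  have hrefl : ∀ x, |f x| < ε → f (levelReflection f G x) = -f x := fun x hx =>
    (h.apply_levelReflection (by linarith)).1
  have hHolder : ∀ x, |f x| < ε → |g (levelReflection f G x) - g x| ≤ 2 * K * ε ^ ν := by
    intro x hx
    refine (hgH _ x (by rwa [hrefl x hx, abs_neg]) hx).trans ?_
    rw [dist_eq_norm, h.norm_levelReflection_sub_self (by linarith)]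
    have h2 : (2 * |f x|) ^ ν ≤ 2 * ε ^ ν := by
      calc (2 * |f x|) ^ ν ≤ (2 * ε) ^ ν := by gcongr
        _ = 2 ^ ν * ε ^ ν := Real.mul_rpow zero_le_two hε.le
        _ ≤ 2 * ε ^ ν := by
          gcongr
          simpa using Real.rpow_le_rpow_of_exponent_le one_le_two hν1
    calc K * (2 * |f x|) ^ ν ≤ K * (2 * ε ^ ν) := by gcongr
      _ = 2 * K * ε ^ ν := by ring
  have hzero : ∀ᵐ x ∂μ.restrict {x | |f x| < ε}, f x ≠ 0 :=
    ae_restrict_of_ae (by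
      rw [ae_iff]
      simpa using h.measure_zero_level_eq_zero μ hr hfin)
  have key := abs_integral_mul_le_of_odd (h.measurable_levelReflection hG)
    (by positivity : 0 ≤ M * ε) hmap hg hw ((ae_restrict_iff' hT).2 (ae_of_all _ hgK))
    ((ae_restrict_iff' hT).2 (ae_of_all _ hHolder)) hw1
    (by
      filter_upwards [hzero, ae_restrict_mem hT] with x hx0 hx
      exact hwodd x _ hx (hrefl x hx) hx0)
  rw [measureReal_restrict_apply_univ] at key
  have hpow : ε ≤ ε ^ ν := by
    simpa using Real.rpow_le_rpow_of_exponent_ge hε hε1 hν1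
  have hpow' : ε ^ (ν + 1) = ε ^ ν * ε := by rw [Real.rpow_add hε, Real.rpow_one]
  calc _ ≤ (2 * K * ε ^ ν + 2 * (M * ε) * K) * μ.real {x | |f x| < ε} := key
    _ ≤ (2 * K * ε ^ ν + 2 * (M * ε ^ ν) * K) * (V * ε) := by
      gcongr
      exact htube ε hε hερ₁
    _ = (2 + 2 * M) * V * K * ε ^ (ν + 1) := by rw [hpow']; ring

end DiffuseVolume

/-- Convergence of diffuse volume integrals with rate `ε^{ν+1}` for Hölder
continuous integrands on the closure of `Γ_ε`. -/
theorem diffuse_volume_integral_holder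
    (n : ℕ) (hn : 2 ≤ n)
    (D : Set (EuclideanSpace ℝ (Fin n)))
    (hD_open : IsOpen D) (hD_bdd : Bornology.IsBounded D) (hD_ne : D.Nonempty)
    (dD : EuclideanSpace ℝ (Fin n) → ℝ)
    (hdD : ∀ x, dD x = Metric.infDist x D - Metric.infDist x Dᶜ)
    (Dt : ℝ → Set (EuclideanSpace ℝ (Fin n)))
    (hDt : ∀ t, Dt t = {x | dD x < t})
    (Γ : ℝ → Set (EuclideanSpace ℝ (Fin n)))
    (hΓ : ∀ ε : ℝ, Γ ε = Dt ε \ closure (Dt (-ε)))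
    (ε₀ : ℝ) (hε₀ : 0 < ε₀)
    (hproj : ∀ z ∈ Γ (2 * ε₀), ∃! y, y ∈ frontier D ∧ dist z y = Metric.infDist z (frontier D))
    (hC11 : ∃ U : Set (EuclideanSpace ℝ (Fin n)), IsOpen U ∧ frontier D ⊆ U ∧
      ContDiffOn ℝ 1 dD U ∧ ∃ L : NNReal, LipschitzOnWith L (fun x => fderiv ℝ dD x) U)
    (S : ℝ → ℝ) (ζ₁ ζ₂ α : ℝ) (hζ₁ : 0 < ζ₁) (hζ₂ : 0 < ζ₂) (hα : 0 < α)
    (hS_lip : ∃ L : NNReal, LipschitzWith L S)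
    (hS_sign : ∀ t : ℝ, 1 ≤ |t| → S t = t / |t|)
    (hS_pos : ∀ t : ℝ, |t| < 1 → 0 < deriv S t)
    (hS_odd : ∀ t : ℝ, S (-t) = -S t)
    (hS2 : ∀ t ∈ Set.Ioo (0:ℝ) 2,
      ζ₁ * t ^ α ≤ (1 + S (t - 1)) / 2 ∧ (1 + S (t - 1)) / 2 ≤ ζ₂ * t ^ α)
    (ω : ℝ → EuclideanSpace ℝ (Fin n) → ℝ)
    (hω : ∀ ε : ℝ, 0 < ε → ∀ x, ω ε x = (1 + S (-(dD x) / ε)) / 2)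
    (Ω : Set (EuclideanSpace ℝ (Fin n))) (hΩ_open : IsOpen Ω) (hΩ_bdd : Bornology.IsBounded Ω)
    (hΩD : closure (Dt ε₀) ⊆ Ω)
 :
    ∀ ν : ℝ, 0 < ν → ν ≤ 1 →
      ∃ C : ℝ, 0 < C ∧ ∀ ε ∈ Set.Ioc (0:ℝ) ε₀,
        ∀ h : EuclideanSpace ℝ (Fin n) → ℝ, Measurable h → IntegrableOn h Ω volume →
          ∀ K : ℝ, (∀ x ∈ closure (Γ ε), |h x| ≤ K) →
            (∀ x ∈ closure (Γ ε), ∀ y ∈ closure (Γ ε), |h x - h y| ≤ K * dist x y ^ ν) →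
            |(∫ x in Ω, h x * ω ε x) - ∫ x in D, h x| ≤ C * K * ε ^ (ν + 1) := by
  intro ν hν hν1
  have hDc : Dᶜ.Nonempty := by
    rw [nonempty_compl]
    rintro rfl
    have : Nontrivial (EuclideanSpace ℝ (Fin n)) :=
      Module.nontrivial_of_finrank_pos (R := ℝ) (by rw [finrank_euclideanSpace_fin]; omega)
    exact NormedSpace.unbounded_univ ℝ _ hD_bdd
  obtain ⟨U, hU, hUD, hdiff, L, hL⟩ := hC11
  obtain ⟨r, hr, heik, hbdd⟩ :=
    exists_isEikonal_signedDist hdD hD_open hD_bdd hD_ne hDc hU hUD hdiff hL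
  obtain ⟨C₀, ρ, hC₀, hρ, hsmall⟩ := heik.exists_abs_integral_tube_le (μ := volume)
    (measurable_gradient dD) hr hbdd.measure_lt_top.ne
  have hcont : Continuous dD := heik.lipschitz.continuous
  have hneg : ∀ x, dD x < 0 ↔ x ∈ D := fun x => signedDist_neg_iff hdD hD_open hDc
  have hS1 : ∀ t, |S t| ≤ 1 := abs_profile_le_one hS_sign hS_odd fun t ht =>
    (mul_nonneg hζ₁.le (Real.rpow_nonneg ht.1.le α)).trans (hS2 t ht).1
  have hS_cont : Continuous S := by
    obtain ⟨_, h⟩ := hS_lip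
    exact h.continuous
  refine ⟨C₀ + volume.real Ω / ρ ^ (ν + 1) + 1, by positivity,
    fun ε hε g hg hgΩ K hgK hgH => ?_⟩
  obtain ⟨hε0, hεε₀⟩ := hε
  have hTΓ : ∀ x, |dD x| < ε → x ∈ closure (Γ ε) := by
    intro x hx
    refine subset_closure ?_
    rw [hΓ, hDt, hDt]
    refine ⟨(abs_lt.1 hx).2, fun hx' => ?_⟩
    have h1 : closure {x | dD x < -ε} ⊆ {x | dD x ≤ -ε} :=
      closure_minimal (fun y (hy : dD y < -ε) => hy.le) (isClosed_le hcont continuous_const)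
    exact (abs_lt.1 hx).1.not_ge (h1 hx')
  have hK : 0 ≤ K := by
    obtain ⟨x, hx⟩ := nonempty_frontier_iff.2 ⟨hD_ne, nonempty_compl.1 hDc⟩
    refine (abs_nonneg _).trans (hgK x (hTΓ x ?_))
    rwa [signedDist_eq_zero_of_mem_frontier hdD hx, abs_zero]
  have hDtΩ : ∀ x, dD x < ε → x ∈ Ω := fun x hx =>
    hΩD (subset_closure (by rw [hDt]; exact hx.trans_le hεε₀))
  have hTΩ : {x | |dD x| < ε} ⊆ Ω := fun x hx => hDtΩ x (abs_lt.1 hx).2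
  have hDΩ : D ⊆ Ω := fun x hx => hDtΩ x (((hneg x).2 hx).trans hε0)
  have hωm : Measurable (ω ε) := by
    have : ω ε = fun x => (1 + S (-(dD x) / ε)) / 2 := funext fun x => hω ε hε0 x
    rw [this]
    exact (Continuous.div_const (continuous_const.add
      (hS_cont.comp (hcont.neg.div_const ε))) 2).measurable
  have hωb : ∀ x, 0 ≤ ω ε x ∧ ω ε x ≤ 1 := by
    intro x
    rw [hω ε hε0]
    have := abs_le.1 (hS1 (-(dD x) / ε))
    constructor <;> linarith
  let w : EuclideanSpace ℝ (Fin n) → ℝ := fun x => ω ε x - D.indicator 1 x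
  have hwm : Measurable w := hωm.sub (measurable_one.indicator hD_open.measurableSet)
  have hw_mem : ∀ x ∈ D, w x = ω ε x - 1 := fun x hx => by simp [w, hx]
  have hw_notMem : ∀ x ∉ D, w x = ω ε x := fun x hx => by simp [w, hx]
  have hw1 : ∀ x, |w x| ≤ 1 := by
    intro x
    rw [abs_le]
    obtain ⟨h0, h1⟩ := hωb x
    by_cases hx : x ∈ D
    · rw [hw_mem x hx]
      constructor <;> linarith
    · rw [hw_notMem x hx]
      constructor <;> linarith
  have hw_supp : ∀ x, ε ≤ |dD x| → w x = 0 := by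
    intro x hx
    have habs : |-(dD x) / ε| = |dD x| / ε := by rw [abs_div, abs_neg, abs_of_pos hε0]
    have hdx : 0 < |dD x| := hε0.trans_le hx
    have hS := hS_sign (-(dD x) / ε) (by rwa [habs, one_le_div hε0])
    rw [habs, div_div_div_cancel_right₀ hε0.ne'] at hS
    rcases (abs_pos.1 hdx).lt_or_gt with h | h
    · rw [abs_of_neg h, div_self (neg_pos.2 h).ne'] at hS
      rw [hw_mem x ((hneg x).1 h), hω ε hε0, hS]
      norm_num
    · rw [abs_of_pos h, neg_div (dD x) (dD x), div_self h.ne'] at hS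
      rw [hw_notMem x (fun hxD => h.not_gt ((hneg x).2 hxD)), hω ε hε0, hS]
      norm_num
  have hw_odd : ∀ x y, dD y = -dD x → dD x ≠ 0 → w y = -w x := by
    intro x y hxy hx
    have hSy : S (-(dD y) / ε) = -S (-(dD x) / ε) := by rw [hxy, ← hS_odd]; congr 1; ring
    rcases hx.lt_or_gt with h | h
    · rw [hw_mem x ((hneg x).1 h), hw_notMem y (fun hy => by linarith [(hneg y).2 hy]),
        hω ε hε0, hω ε hε0, hSy]
      ring
    · rw [hw_mem y ((hneg y).1 (by linarith)), hw_notMem x (fun hx => by linarith [(hneg x).2 hx]),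
        hω ε hε0, hω ε hε0, hSy]
      ring
  have hT : MeasurableSet {x | |dD x| < ε} := (isOpen_Iio.preimage hcont.abs).measurableSet
  have hgω : IntegrableOn (fun x => g x * ω ε x) Ω volume :=
    hgΩ.mul_bdd (c := 1) hωm.aestronglyMeasurable (ae_of_all _ fun x => by
      rw [Real.norm_eq_abs, abs_of_nonneg (hωb x).1]
      exact (hωb x).2)
  have hsplit : (∫ x in Ω, g x * ω ε x) - ∫ x in D, g x
      = ∫ x in {x | |dD x| < ε}, g x * w x := by
    have h1 : ∫ x in D, g x = ∫ x in Ω, D.indicator g x := by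
      rw [setIntegral_indicator hD_open.measurableSet, inter_eq_self_of_subset_right hDΩ]
    rw [h1, ← integral_sub hgω (hgΩ.indicator hD_open.measurableSet)]
    have h2 : ∀ x, g x * ω ε x - D.indicator g x = g x * w x := by
      intro x
      by_cases hx : x ∈ D
      · rw [hw_mem x hx, indicator_of_mem hx]
        ring
      · rw [hw_notMem x hx, indicator_of_notMem hx]
        ring
    simp only [h2]
    refine setIntegral_eq_of_subset_of_forall_sdiff_eq_zero hΩ_open.measurableSet hTΩ ?_
    intro x hx
    rw [hw_supp x (not_lt.1 hx.2), mul_zero]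
  have hεpow : 0 < ε ^ (ν + 1) := Real.rpow_pos_of_pos hε0 _
  have hρpow : 0 < ρ ^ (ν + 1) := Real.rpow_pos_of_pos hρ _
  rw [hsplit]
  rcases le_total ε ρ with hερ | hρε
  · refine (hsmall ε hε0 hερ ν hν hν1 g w hg hwm hw1 (fun x y _ => hw_odd x y) K hK
      (fun x hx => hgK x (hTΓ x hx))
      (fun x y hx hy => hgH x (hTΓ x hx) y (hTΓ y hy))).trans ?_
    gcongr
    have : 0 ≤ volume.real Ω / ρ ^ (ν + 1) := by positivity
    linarith
  · have hΩfin : volume Ω < ∞ := hΩ_bdd.measure_lt_top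
    have hle : |∫ x in {x | |dD x| < ε}, g x * w x| ≤ K * volume.real {x | |dD x| < ε} := by
      rw [← Real.norm_eq_abs]
      refine norm_setIntegral_le_of_norm_le_const ((measure_mono hTΩ).trans_lt hΩfin) ?_
      intro x hx
      rw [Real.norm_eq_abs, abs_mul]
      exact (mul_le_of_le_one_right (abs_nonneg _) (hw1 x)).trans (hgK x (hTΓ x hx))
    calc _ ≤ K * volume.real {x | |dD x| < ε} := hle
      _ ≤ K * volume.real Ω := by
        gcongr
        exact hΩfin.ne
      _ = volume.real Ω / ρ ^ (ν + 1) * K * ρ ^ (ν + 1) := by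
        field_simp
      _ ≤ (C₀ + volume.real Ω / ρ ^ (ν + 1) + 1) * K * ε ^ (ν + 1) := by
        gcongr
        linarith
end
end
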